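/- Let Ω be the open unit disc. Then there exists κ₀ > 0 such that for all κ > κ₀ the lower and upper local critical fields coincide: H^{loc}(κ) = H̄^{loc}(κ). -/

import Mathlib

open MeasureTheory Filter Set Topology

noncomputable section

namespace SC

/-- The plane `ℝ²`. -/
abbrev Plane := ℝ × ℝ

/-- Squared Euclidean norm on the plane. -/
def esq (v : Plane) : ℝ := v.1 ^ 2 + v.2 ^ 2

/-- Euclidean dot product on the plane. -/
def dot2 (v w : Plane) : ℝ := v.1 * w.1 + v.2 * w.2

/-- The reference vector potential `F₀(x) = (-x₂/2, x₁/2)`, with `curl F₀ = 1`. -/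
def F0 : Plane → Plane := fun x => (-x.2 / 2, x.1 / 2)

/-- `u` is of class `Cⁿ` on a neighborhood of the closure of `Ω`. -/
def CNearCl {E : Type*} [NormedAddCommGroup E] [NormedSpace ℝ E]
    (n : ℕ) (Ω : Set Plane) (u : Plane → E) : Prop :=
  ∃ U : Set Plane, IsOpen U ∧ closure Ω ⊆ U ∧ ContDiffOn ℝ n u U

/-- The pointwise squared magnetic gradient `|(-i∇ - B·A)u|²`. -/
def magSq (B : ℝ) (A : Plane → Plane) (u : Plane → ℂ) (x : Plane) : ℝ :=
  ‖(-Complex.I) * fderiv ℝ u x ((1 : ℝ), (0 : ℝ)) - ((B * (A x).1 : ℝ) : ℂ) * u x‖ ^ 2 +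
  ‖(-Complex.I) * fderiv ℝ u x ((0 : ℝ), (1 : ℝ)) - ((B * (A x).2 : ℝ) : ℂ) * u x‖ ^ 2

/-- `curl A = ∂₁A₂ - ∂₂A₁`. -/
def curl2 (A : Plane → Plane) (x : Plane) : ℝ :=
  fderiv ℝ (fun y => (A y).2) x ((1 : ℝ), (0 : ℝ)) -
    fderiv ℝ (fun y => (A y).1) x ((0 : ℝ), (1 : ℝ))

/-- The variational ground state energy `λ₁(B·A)` of the magnetic Neumann Laplacian. -/
def lam1A (Ω : Set Plane) (B : ℝ) (A : Plane → Plane) : ℝ :=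
  sInf { r : ℝ | ∃ u : Plane → ℂ, CNearCl 1 Ω u ∧ (∫ x in Ω, ‖u x‖ ^ 2) ≠ 0 ∧
    r = (∫ x in Ω, magSq B A u x) / (∫ x in Ω, ‖u x‖ ^ 2) }

/-- `λ₁(B) = λ₁(B·F₀)`. -/
def lam1 (Ω : Set Plane) (B : ℝ) : ℝ := lam1A Ω B F0

/-- The Ginzburg–Landau energy functional. -/
def GLenergy (Ω : Set Plane) (κ H : ℝ) (ψ : Plane → ℂ) (A : Plane → Plane) : ℝ :=
  ∫ x in Ω, (magSq (κ * H) A ψ x - κ ^ 2 * ‖ψ x‖ ^ 2 + κ ^ 2 / 2 * ‖ψ x‖ ^ 4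
    + κ ^ 2 * H ^ 2 * (curl2 A x - 1) ^ 2)

/-- Admissible Ginzburg–Landau configurations. -/
def GLadm (Ω : Set Plane) (ψ : Plane → ℂ) (A : Plane → Plane) : Prop :=
  CNearCl 1 Ω ψ ∧ CNearCl 1 Ω A

/-- The normal state is a minimizer at `(κ, H)`. -/
def NormalMin (Ω : Set Plane) (κ H : ℝ) : Prop :=
  ∀ ψ A, GLadm Ω ψ A → 0 ≤ GLenergy Ω κ H ψ A

/-- The normal state is the unique minimizer at `(κ, H)`. -/
def NormalUnique (Ω : Set Plane) (κ H : ℝ) : Prop :=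
  NormalMin Ω κ H ∧
  ∀ ψ A, GLadm Ω ψ A → (∫ x in Ω, ‖ψ x‖ ^ 2) ≠ 0 → 0 < GLenergy Ω κ H ψ A

/-- `(ψ, A)` is a minimizer of the Ginzburg–Landau energy at `(κ, H)`. -/
def IsGLMin (Ω : Set Plane) (κ H : ℝ) (ψ : Plane → ℂ) (A : Plane → Plane) : Prop :=
  GLadm Ω ψ A ∧ ∀ ψ' A', GLadm Ω ψ' A' → GLenergy Ω κ H ψ A ≤ GLenergy Ω κ H ψ' A'

/-- Lower global critical field. -/
def HC3low (Ω : Set Plane) (κ : ℝ) : ℝ := sInf {H : ℝ | 0 < H ∧ NormalMin Ω κ H}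

/-- Upper global critical field. -/
def HC3up (Ω : Set Plane) (κ : ℝ) : ℝ :=
  sInf {H : ℝ | 0 < H ∧ ∀ H', H < H' → NormalUnique Ω κ H'}

/-- Lower local critical field. -/
def HlocLow (Ω : Set Plane) (κ : ℝ) : ℝ :=
  sInf {H : ℝ | 0 < H ∧ κ ^ 2 ≤ lam1 Ω (κ * H)}

/-- Upper local critical field. -/
def HlocUp (Ω : Set Plane) (κ : ℝ) : ℝ :=
  sInf {H : ℝ | 0 < H ∧ ∀ H', H < H' → κ ^ 2 ≤ lam1 Ω (κ * H')}

/-- The inward unit normal `ν(s) = (-γ₂'(s), γ₁'(s))`. -/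
def nuVec (γ : ℝ → Plane) (s : ℝ) : Plane := (-(deriv γ s).2, (deriv γ s).1)

/-- The curvature `k(s) = ⟨γ''(s), ν(s)⟩`. -/
def curvOf (γ : ℝ → Plane) (s : ℝ) : ℝ := dot2 (deriv (deriv γ) s) (nuVec γ s)

/-- The maximal curvature. -/
def kmaxOf (γ : ℝ → Plane) : ℝ := sSup (Set.range (curvOf γ))

/-- A smooth counterclockwise arclength parametrization of the boundary of `Ω`. -/
structure BoundaryParam (Ω : Set Plane) where
  γ : ℝ → Plane
  L : ℝ
  L_pos : 0 < L
  smooth : ContDiff ℝ (⊤ : ℕ∞) γ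
  periodic : Function.Periodic γ L
  unit_speed : ∀ s, esq (deriv γ s) = 1
  injOn : Set.InjOn γ (Set.Ico 0 L)
  range_eq : Set.range γ = frontier Ω
  inward : ∀ s, ∃ ε > 0, ∀ t ∈ Set.Ioo (0 : ℝ) ε, γ s + t • nuVec γ s ∈ Ω

/-- The non-degeneracy assumption: finitely many points of maximal curvature,
all of them non-degenerate maxima. -/
def NonDegen {Ω : Set Plane} (P : BoundaryParam Ω) : Prop :=
  ∃ (N : ℕ) (s : Fin N → ℝ), 0 < N ∧ (∀ j, s j ∈ Set.Ico 0 P.L) ∧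
    (∀ j, curvOf P.γ (s j) = kmaxOf P.γ) ∧
    (∀ t ∈ Set.Ico 0 P.L, (∀ j, t ≠ s j) → curvOf P.γ t < kmaxOf P.γ) ∧
    (∀ j, deriv (deriv (curvOf P.γ)) (s j) < 0)

/-- The ground state energy `μ(ζ)` of the de Gennes half-line model operator. -/
def muGen (ζ : ℝ) : ℝ :=
  sInf { r : ℝ | ∃ φ : ℝ → ℝ, ContDiff ℝ 1 φ ∧ HasCompactSupport φ ∧
    (∃ τ, 0 < τ ∧ φ τ ≠ 0) ∧
    r = (∫ τ in Set.Ioi (0 : ℝ), ((deriv φ τ) ^ 2 + (τ + ζ) ^ 2 * (φ τ) ^ 2)) /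
        (∫ τ in Set.Ioi (0 : ℝ), (φ τ) ^ 2) }

/-- The de Gennes constant `Θ₀`. -/
def Theta0 : ℝ := sInf (Set.range muGen)

/-- Standard facts about the de Gennes constant, taken as hypotheses. -/
structure DeGennes where
  ξ₀ : ℝ
  u₀ : ℝ → ℝ
  theta_lb : 1 / 2 < Theta0
  theta_ub : Theta0 < 1
  ξ₀_mem : ξ₀ ∈ Set.Ioo (-1 : ℝ) 0
  ξ₀_min : muGen ξ₀ = Theta0
  ξ₀_uniq : ∀ ζ, muGen ζ = Theta0 → ζ = ξ₀
  ξ₀_sq : ξ₀ ^ 2 = Theta0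
  u₀_pos : ∀ τ, 0 ≤ τ → 0 < u₀ τ
  u₀_smooth : ContDiffOn ℝ 2 u₀ (Set.Ici 0)
  u₀_sq_int : IntegrableOn (fun τ => (u₀ τ) ^ 2) (Set.Ioi 0)
  u₀_normalized : (∫ τ in Set.Ioi (0 : ℝ), (u₀ τ) ^ 2) = 1
  u₀_neumann : derivWithin u₀ (Set.Ici 0) 0 = 0
  u₀_ode : ∀ τ ∈ Set.Ioi (0 : ℝ),
    -(deriv (deriv u₀) τ) + (τ + ξ₀) ^ 2 * u₀ τ = Theta0 * u₀ τ

/-- The universal constant `C₁ = u₀(0)²/3`. -/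
def DeGennes.C1 (D : DeGennes) : ℝ := (D.u₀ 0) ^ 2 / 3

/-- Condition (★) on a vector field `A` at field strength `B` with constant `C₀`. -/
def StarCond (Ω : Set Plane) (C₀ B : ℝ) (A : Plane → Plane) : Prop :=
  CNearCl 2 Ω A ∧
  (∀ x ∈ closure Ω, ‖A x‖ ≤ C₀) ∧
  (∀ x ∈ closure Ω, ‖fderiv ℝ A x‖ ≤ C₀) ∧
  (∀ x ∈ closure Ω, ‖fderiv ℝ (fderiv ℝ A) x‖ ≤ C₀) ∧
  (∀ x ∈ closure Ω, |curl2 A x - 1| ≤ C₀ * B ^ (-(1 : ℝ) / 4)) ∧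
  (∀ x ∈ closure Ω, ‖fderiv ℝ (curl2 A) x‖ ≤ C₀ * B ^ (-(1 : ℝ) / 4)) ∧
  (∀ x ∈ frontier Ω, curl2 A x = 1)

/-- The open unit disc. -/
def unitDisc : Set Plane := {x : Plane | x.1 ^ 2 + x.2 ^ 2 < 1}

/-- `Δ_B`: distance from `B/2 + ξ₀√B + δ₀` to the nearest integer. -/
def DeltaB (ξ₀ δ₀ B : ℝ) : ℝ :=
  sInf (Set.range (fun m : ℤ => |(m : ℝ) - B / 2 - ξ₀ * Real.sqrt B - δ₀|))

/-- Euclidean distance to the boundary of `Ω`. -/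
def distBdry (Ω : Set Plane) (x : Plane) : ℝ :=
  sInf ((fun y => Real.sqrt (esq (x - y))) '' frontier Ω)

end SC


namespace SC

/-- The angular weight `B exp (2 * x) / 2 - m` in the logarithmic radial variable `x = log r`. -/
def wt (B : ℝ) (m : ℤ) (x : ℝ) : ℝ := B / 2 * Real.exp (2 * x) - m

@[fun_prop]
theorem continuous_wt (B : ℝ) (m : ℤ) : Continuous (wt B m) := by
  unfold wt; fun_prop

theorem hasDerivAt_wt (B : ℝ) (m : ℤ) (x : ℝ) :
    HasDerivAt (wt B m) (B * Real.exp (2 * x)) x := by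
  have h := (((hasDerivAt_id x).const_mul 2).exp.const_mul (B / 2)).sub_const (m : ℝ)
  refine h.congr_deriv ?_
  simp only [id]; ring

/-- `f` is of class `C¹` with derivative `f'` and vanishes on `(-∞, a]`, where `a ≤ -1`. -/
structure RadAdm (a : ℝ) (f f' : ℝ → ℝ) : Prop where
  le_neg_one : a ≤ -1
  hasDerivAt : ∀ x, HasDerivAt f (f' x) x
  cont : Continuous f'
  eq_zero : ∀ x ≤ a, f x = 0

/-- The radial energy of the angular momentum `m` sector. -/
def radE (B : ℝ) (m : ℤ) (a : ℝ) (f f' : ℝ → ℝ) : ℝ :=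
  ∫ x in a..0, (f' x ^ 2 + wt B m x ^ 2 * f x ^ 2)

/-- The squared radial norm. -/
def radN (a : ℝ) (f : ℝ → ℝ) : ℝ := ∫ x in a..0, Real.exp (2 * x) * f x ^ 2

/-- `l` bounds from below all the radial Rayleigh quotients at field `B`. -/
def RadLB (B l : ℝ) : Prop :=
  ∀ (m : ℤ) (a : ℝ) (f f' : ℝ → ℝ), RadAdm a f f' → l * radN a f ≤ radE B m a f f'

namespace RadAdm

variable {a : ℝ} {f f' : ℝ → ℝ}

theorem continuous (h : RadAdm a f f') : Continuous f :=
  continuous_iff_continuousAt.2 fun x => (h.hasDerivAt x).continuousAt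

theorem deriv_eq_zero (h : RadAdm a f f') {x : ℝ} (hx : x ≤ a) : f' x = 0 := by
  have h1 : HasDerivWithinAt f (f' x) (Iic x) x := (h.hasDerivAt x).hasDerivWithinAt
  have h2 : HasDerivWithinAt f 0 (Iic x) x :=
    (hasDerivWithinAt_const x (Iic x) (0 : ℝ)).congr
      (fun y hy => h.eq_zero y (le_trans hy hx)) (h.eq_zero x hx)
  exact (uniqueDiffOn_Iic x x (mem_Iic.2 le_rfl)).eq_deriv _ h1 h2

end RadAdm

/-- The weighted integral `∫ g f²` over `[a, 0]`. -/
def mom (a : ℝ) (f g : ℝ → ℝ) : ℝ := ∫ x in a..0, g x * f x ^ 2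

theorem mom_mono {a : ℝ} {f g h : ℝ → ℝ} (ha : a ≤ 0) (hf : Continuous f)
    (hg : Continuous g) (hh : Continuous h) (hgh : ∀ x ≤ 0, g x ≤ h x) :
    mom a f g ≤ mom a f h := by
  refine intervalIntegral.integral_mono_on ha (Continuous.intervalIntegrable (by fun_prop) _ _)
    (Continuous.intervalIntegrable (by fun_prop) _ _) fun x hx => ?_
  exact mul_le_mul_of_nonneg_right (hgh x hx.2) (sq_nonneg _)

theorem mom_add {a : ℝ} {f g h : ℝ → ℝ} (hf : Continuous f)
    (hg : Continuous g) (hh : Continuous h) :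
    mom a f (fun x => g x + h x) = mom a f g + mom a f h := by
  unfold mom
  rw [← intervalIntegral.integral_add (Continuous.intervalIntegrable (by fun_prop) _ _)
    (Continuous.intervalIntegrable (by fun_prop) _ _)]
  congr 1; ext x; ring

theorem mom_const_mul {a : ℝ} {f g : ℝ → ℝ} (c : ℝ) :
    mom a f (fun x => c * g x) = c * mom a f g := by
  unfold mom
  rw [← intervalIntegral.integral_const_mul]
  congr 1; ext x; ring

/-- Moments of quadratic polynomials in the weight. -/
theorem mom_quad {a : ℝ} {f : ℝ → ℝ} (hf : Continuous f) (B : ℝ) (m : ℤ) (p q r : ℝ) :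
    mom a f (fun x => p + q * wt B m x + r * wt B m x ^ 2) =
      p * mom a f (fun _ => 1) + q * mom a f (wt B m) + r * mom a f (fun x => wt B m x ^ 2) := by
  rw [mom_add hf (by fun_prop) (by fun_prop), mom_add hf (by fun_prop) (by fun_prop),
    mom_const_mul, mom_const_mul]
  have : mom a f (fun _ => p) = p * mom a f (fun _ => 1) := by
    rw [← mom_const_mul]; simp
  rw [this]

theorem radE_eq {B : ℝ} {m : ℤ} {a : ℝ} {f f' : ℝ → ℝ} (hf : Continuous f) (hf' : Continuous f') :
    radE B m a f f' = (∫ x in a..0, f' x ^ 2) + mom a f (fun x => wt B m x ^ 2) := by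
  unfold radE mom
  exact intervalIntegral.integral_add (Continuous.intervalIntegrable (by fun_prop) _ _)
    (Continuous.intervalIntegrable (by fun_prop) _ _)

theorem radN_eq (a : ℝ) (f : ℝ → ℝ) : radN a f = mom a f (fun x => Real.exp (2 * x)) := rfl

theorem exp_eq_wt {B : ℝ} (hB : B ≠ 0) (m : ℤ) (x : ℝ) :
    Real.exp (2 * x) = 2 / B * (wt B m x + m) := by
  unfold wt; field_simp; ring

theorem radN_mul {B : ℝ} (hB : B ≠ 0) (m : ℤ) {a : ℝ} {f : ℝ → ℝ} (hf : Continuous f) :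
    B / 2 * radN a f = mom a f (wt B m) + m * mom a f (fun _ => 1) := by
  have h := mom_quad (a := a) hf B m (2 / B * m) (2 / B) 0
  rw [radN_eq]
  have e : (fun x => Real.exp (2 * x)) =
      fun x => 2 / B * m + 2 / B * wt B m x + 0 * wt B m x ^ 2 := by
    ext x; rw [exp_eq_wt hB m]; ring
  rw [e, h]; field_simp; ring

theorem mom_exp_mul_wt {B : ℝ} (hB : B ≠ 0) (m : ℤ) {a : ℝ} {f : ℝ → ℝ} (hf : Continuous f) :
    B / 2 * mom a f (fun x => Real.exp (2 * x) * wt B m x) =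
      mom a f (fun x => wt B m x ^ 2) + m * mom a f (wt B m) := by
  have h := mom_quad (a := a) hf B m 0 (2 / B * m) (2 / B)
  have e : (fun x => Real.exp (2 * x) * wt B m x) =
      fun x => 0 + 2 / B * m * wt B m x + 2 / B * wt B m x ^ 2 := by
    ext x; rw [exp_eq_wt hB m]; ring
  rw [e, h]; field_simp; ring

theorem wt_le {B : ℝ} (hB : 0 ≤ B) (m : ℤ) {x : ℝ} (hx : x ≤ 0) : wt B m x ≤ B / 2 - m := by
  have : Real.exp (2 * x) ≤ 1 := Real.exp_le_one_iff.2 (by linarith)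
  unfold wt; nlinarith

theorem wt_sub_one (B : ℝ) (m : ℤ) (x : ℝ) : wt B (m - 1) x = wt B m x + 1 := by
  unfold wt; push_cast; ring

theorem wt_add_one (B : ℝ) (m : ℤ) (x : ℝ) : wt B (m + 1) x = wt B m x - 1 := by
  unfold wt; push_cast; ring

/-- Comparison with the neighbouring angular momenta. -/
theorem abs_mom_wt_le {B l e : ℝ} (h : RadLB B l) {m : ℤ} {a : ℝ} {f f' : ℝ → ℝ}
    (hf : RadAdm a f f') (hE : radE B m a f f' ≤ l * radN a f + e) :
    |2 * mom a f (wt B m)| ≤ mom a f (fun _ => 1) + e := by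
  have h1 := h (m - 1) a f f' hf
  have h2 := h (m + 1) a f f' hf
  have hc := hf.continuous
  rw [radE_eq hc hf.cont] at h1 h2 hE
  have e1 := mom_quad (a := a) hc B m 1 2 1
  have e2 := mom_quad (a := a) hc B m 1 (-2) 1
  have g1 : (fun x => wt B (m - 1) x ^ 2) = fun x => 1 + 2 * wt B m x + 1 * wt B m x ^ 2 := by
    ext x; rw [wt_sub_one]; ring
  have g2 : (fun x => wt B (m + 1) x ^ 2) = fun x => 1 + -2 * wt B m x + 1 * wt B m x ^ 2 := by
    ext x; rw [wt_add_one]; ring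
  rw [g1, e1] at h1
  rw [g2, e2] at h2
  rw [abs_le]; constructor <;> linarith

/-- Integration by parts for `∫ (f' + h f)² ≥ 0`. -/
theorem riccati_lower_bound {a : ℝ} {f f' h h' : ℝ → ℝ} (hf : RadAdm a f f')
    (hh : ∀ x, HasDerivAt h (h' x) x) (hh' : Continuous h') :
    mom a f h' ≤ (∫ x in a..0, f' x ^ 2) + mom a f (fun x => h x ^ 2) + h 0 * f 0 ^ 2 := by
  have hc := hf.continuous
  have hc' := hf.cont
  have hhc : Continuous h := continuous_iff_continuousAt.2 fun x => (hh x).continuousAt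
  have ha : a ≤ 0 := by linarith [hf.le_neg_one]
  have h1 : ∫ x in a..0, (h' x * f x ^ 2 + h x * (2 * f x * f' x)) = h 0 * f 0 ^ 2 := by
    rw [intervalIntegral.integral_eq_sub_of_hasDerivAt (f := fun x => h x * f x ^ 2)
      (fun x _ => ?_) (Continuous.intervalIntegrable (by fun_prop) _ _)]
    · simp [hf.eq_zero a le_rfl]
    · refine ((hh x).mul ((hf.hasDerivAt x).pow 2)).congr_deriv ?_
      simp
  have h2 : 0 ≤ ∫ x in a..0, (f' x + h x * f x) ^ 2 :=
    intervalIntegral.integral_nonneg ha fun x _ => sq_nonneg _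
  have h3 : ∫ x in a..0, (f' x + h x * f x) ^ 2 = ((∫ x in a..0, f' x ^ 2) +
      mom a f (fun x => h x ^ 2)) + ((∫ x in a..0, (h' x * f x ^ 2 + h x * (2 * f x * f' x)))
      - mom a f h') := by
    unfold mom
    rw [← intervalIntegral.integral_add (Continuous.intervalIntegrable (by fun_prop) _ _)
        (Continuous.intervalIntegrable (by fun_prop) _ _),
      ← intervalIntegral.integral_sub (Continuous.intervalIntegrable (by fun_prop) _ _)
        (Continuous.intervalIntegrable (by fun_prop) _ _),
      ← intervalIntegral.integral_add (Continuous.intervalIntegrable (by fun_prop) _ _)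
        (Continuous.intervalIntegrable (by fun_prop) _ _)]
    congr 1; ext x; ring
  linarith

theorem exp_two_mul_le_one {x : ℝ} (hx : x ≤ 0) : Real.exp (2 * x) ≤ 1 :=
  Real.exp_le_one_iff.2 (by linarith)

theorem radN_le_mom_one {a : ℝ} {f : ℝ → ℝ} (ha : a ≤ 0) (hf : Continuous f) :
    radN a f ≤ mom a f (fun _ => 1) :=
  mom_mono ha hf (by fun_prop) (by fun_prop) fun _ hx => exp_two_mul_le_one hx

/-- Trace inequality at the boundary point `x = 0`. -/
theorem trace_le {a : ℝ} {f f' : ℝ → ℝ} (hf : RadAdm a f f') (c : ℝ) :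
    c * f 0 ^ 2 ≤ (∫ x in a..0, f' x ^ 2) + (c ^ 2 + 2 * c) * radN a f := by
  have hc := hf.continuous
  have ha : a ≤ 0 := by linarith [hf.le_neg_one]
  have h := riccati_lower_bound (h := fun x => -c * Real.exp (2 * x))
    (h' := fun x => (-2 * c) * Real.exp (2 * x)) hf (fun x => by
      refine (((hasDerivAt_id x).const_mul 2).exp.const_mul (-c)).congr_deriv ?_
      simp only [id]; ring) (by fun_prop)
  rw [mom_const_mul, ← radN_eq] at h
  have h2 : mom a f (fun x => (-c * Real.exp (2 * x)) ^ 2) ≤ c ^ 2 * radN a f := by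
    rw [radN_eq, ← mom_const_mul]
    refine mom_mono ha hc (by fun_prop) (by fun_prop) fun x hx => ?_
    have := exp_two_mul_le_one hx
    have := Real.exp_pos (2 * x)
    have : Real.exp (2 * x) ^ 2 ≤ Real.exp (2 * x) := by nlinarith
    nlinarith [sq_nonneg c]
  simp only [mul_zero, Real.exp_zero, mul_one] at h
  linarith

/-- A uniform lower bound of order `B` for the radial energies. -/
theorem radE_ge {B : ℝ} (hB : 0 < B) {m : ℤ} {a : ℝ} {f f' : ℝ → ℝ} (hf : RadAdm a f f') :
    (B / 2 - √B) * radN a f ≤ 4 * radE B m a f f' := by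
  have hc := hf.continuous
  have ha : a ≤ 0 := by linarith [hf.le_neg_one]
  have hpos : ∀ x, 0 < B + wt B m x ^ 2 := fun x => by positivity
  have hs := Real.sq_sqrt hB.le
  have hs0 := Real.sqrt_pos.2 hB
  set s := √B with hsdef
  have h := riccati_lower_bound (h := fun x => B * wt B m x / (B + wt B m x ^ 2))
    (h' := fun x => B * (B * Real.exp (2 * x)) * (B - wt B m x ^ 2) / (B + wt B m x ^ 2) ^ 2) hf
    (fun x => by
      have h1 := hasDerivAt_wt B m x
      have h2 := ((h1.const_mul B).div ((h1.fun_pow 2).const_add B) (hpos x).ne')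
      refine h2.congr_deriv ?_
      have := (hpos x).ne'
      field_simp
      push_cast; ring) (by
      refine Continuous.div (by fun_prop) (by fun_prop) fun x => (pow_pos (hpos x) 2).ne')
  have hhc : Continuous (fun x => B * wt B m x / (B + wt B m x ^ 2)) :=
    Continuous.div (by fun_prop) (by fun_prop) fun x => (hpos x).ne'
  have hhc' : Continuous (fun x => B * (B * Real.exp (2 * x)) * (B - wt B m x ^ 2) /
      (B + wt B m x ^ 2) ^ 2) :=
    Continuous.div (by fun_prop) (by fun_prop) fun x => (pow_pos (hpos x) 2).ne'
  have hP : mom a f (fun x => (B * wt B m x / (B + wt B m x ^ 2)) ^ 2) ≤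
      mom a f (fun x => wt B m x ^ 2) := by
    refine mom_mono ha hc (by fun_prop) (by fun_prop) fun x _ => ?_
    rw [div_pow, div_le_iff₀ (pow_pos (hpos x) 2)]
    nlinarith [sq_nonneg (wt B m x), sq_nonneg (wt B m x ^ 2), sq_nonneg (wt B m x ^ 3),
      mul_nonneg hB.le (sq_nonneg (wt B m x ^ 2))]
  have hL : B * radN a f + -3 * mom a f (fun x => wt B m x ^ 2) ≤
      mom a f (fun x => B * (B * Real.exp (2 * x)) * (B - wt B m x ^ 2) /
      (B + wt B m x ^ 2) ^ 2) := by
    rw [radN_eq, ← mom_const_mul, ← mom_const_mul, ← mom_add hc (by fun_prop) (by fun_prop)]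
    refine mom_mono ha hc (by fun_prop) hhc' fun x hx => ?_
    rw [le_div_iff₀ (pow_pos (hpos x) 2)]
    have hz := exp_two_mul_le_one hx
    have hz0 := Real.exp_pos (2 * x)
    set z := Real.exp (2 * x)
    set y := wt B m x ^ 2
    have hy : 0 ≤ y := sq_nonneg _
    have k1 : (B * z + -3 * y) ≤ z * (B - 3 * y) := by nlinarith
    have k2 : z * (B - 3 * y) * (B + y) ^ 2 ≤ B * (B * z) * (B - y) := by
      have : (B - 3 * y) * (B + y) ^ 2 ≤ B * B * (B - y) := by
        nlinarith [mul_nonneg hy hy, mul_nonneg (mul_nonneg hy hy) hy,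
          mul_nonneg (mul_nonneg hy hy) hB.le]
      nlinarith [mul_le_mul_of_nonneg_left this hz0.le]
    exact le_trans (mul_le_mul_of_nonneg_right k1 (sq_nonneg _)) k2
  have h0 : B * wt B m 0 / (B + wt B m 0 ^ 2) ≤ s / 2 := by
    rw [div_le_iff₀ (hpos 0)]
    nlinarith [mul_nonneg hs0.le (sq_nonneg (s - wt B m 0))]
  have ht := trace_le hf s
  have hf0 := mul_le_mul_of_nonneg_right h0 (sq_nonneg (f 0))
  rw [radE_eq hc hf.cont]
  have hK : 0 ≤ ∫ x in a..0, f' x ^ 2 := intervalIntegral.integral_nonneg ha fun x _ => sq_nonneg _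
  rw [hs] at ht
  linarith

/-- The uncertainty-type inequality obtained from a linear weight vanishing at the boundary. -/
theorem uncertainty {B : ℝ} {m : ℤ} {a : ℝ} {f f' : ℝ → ℝ} (hf : RadAdm a f f') :
    B / 2 * radN a f ≤ (∫ x in a..0, f' x ^ 2) + 1 / 4 * (mom a f (fun x => wt B m x ^ 2)
      - 2 * (B / 2 - m) * mom a f (wt B m) + (B / 2 - m) ^ 2 * mom a f (fun _ => 1)) := by
  have hc := hf.continuous
  have h := riccati_lower_bound (h := fun x => 1 / 2 * (wt B m x - (B / 2 - m)))
    (h' := fun x => 1 / 2 * (B * Real.exp (2 * x))) hf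
    (fun x => ((hasDerivAt_wt B m x).sub_const _).const_mul _) (by fun_prop)
  rw [mom_const_mul, mom_const_mul, ← radN_eq] at h
  have e := mom_quad (a := a) hc B m (1 / 4 * (B / 2 - m) ^ 2) (-(1 / 2) * (B / 2 - m)) (1 / 4)
  have g : (fun x => (1 / 2 * (wt B m x - (B / 2 - m))) ^ 2) = fun x => 1 / 4 * (B / 2 - m) ^ 2 +
      -(1 / 2) * (B / 2 - m) * wt B m x + 1 / 4 * wt B m x ^ 2 := by
    ext x; ring
  rw [g, e] at h
  have h0 : wt B m 0 = B / 2 - m := by simp [wt]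
  simp [h0] at h
  linarith

/-- Virial inequality obtained by dilating towards the interior of the disc. -/
theorem boundary_dilation {B l e k : ℝ} (hB : 1 ≤ B) (hl : 0 ≤ l) (hlB : l ≤ B) (hk : 0 < k)
    (hk1 : k ≤ 1) (h : RadLB B l) {m : ℤ} {a : ℝ} {f f' : ℝ → ℝ}
    (hf : RadAdm a f f') (hE : radE B m a f f' ≤ l * radN a f + e)
    (hm : √l + k ≤ B / 2 - m) :
    2 * k / B * l * radN a f ≤
      2 * k * mom a f (fun x => Real.exp (2 * x) * wt B m x) + k ^ 2 * radN a f + e := by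
  have hc := hf.continuous
  have hc' := hf.cont
  have ha := hf.le_neg_one
  have hB0 : 0 < B := by linarith
  set c := 1 / 2 * Real.log (1 + 2 * k / B) with hcdef
  have hq : 0 < 2 * k / B := by positivity
  have hc0 : 0 ≤ c := by
    have := Real.log_nonneg (x := 1 + 2 * k / B) (by linarith)
    positivity
  have hc1 : c ≤ 1 := by
    have h1 := Real.log_le_sub_one_of_pos (x := 1 + 2 * k / B) (by linarith)
    have h2 : 2 * k / B ≤ 2 := by rw [div_le_iff₀ hB0]; nlinarith
    linarith
  have hexp : Real.exp (2 * c) = 1 + 2 * k / B := by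
    rw [hcdef, ← mul_assoc]; norm_num
    exact Real.exp_log (by linarith)
  have hg : RadAdm a (fun x => f (x - c)) (fun x => f' (x - c)) :=
    ⟨ha, fun x => by simpa using (hf.hasDerivAt (x - c)).comp_sub_const x c, by fun_prop,
      fun x hx => hf.eq_zero _ (by linarith)⟩
  have h1 := h m a _ _ hg
  set H : ℝ → ℝ := fun y => f' y ^ 2 + wt B m (y + c) ^ 2 * f y ^ 2
    - l * (Real.exp (2 * (y + c)) * f y ^ 2) with hH
  have hHc : Continuous H := by fun_prop
  have h2 : 0 ≤ ∫ y in (a - c)..(0 - c), H y := by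
    have : ∫ y in (a - c)..(0 - c), H y = radE B m a (fun x => f (x - c)) (fun x => f' (x - c))
        - l * radN a (fun x => f (x - c)) := by
      rw [← intervalIntegral.integral_comp_sub_right]
      unfold radE radN
      rw [← intervalIntegral.integral_const_mul, ← intervalIntegral.integral_sub
        (Continuous.intervalIntegrable (by fun_prop) _ _)
        (Continuous.intervalIntegrable (by fun_prop) _ _)]
      simp [hH]
    linarith
  have h3 : ∫ y in (a - c)..a, H y = 0 := by
    rw [intervalIntegral.integral_congr (g := fun _ => 0), intervalIntegral.integral_zero]
    intro y hy
    rw [uIcc_of_le (by linarith)] at hy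
    simp [hH, hf.eq_zero y hy.2, hf.deriv_eq_zero hy.2]
  have h4 : 0 ≤ ∫ y in (0 - c)..0, H y := by
    refine intervalIntegral.integral_nonneg (by linarith) fun y hy => ?_
    have e1 : 1 ≤ Real.exp (2 * (y + c)) := Real.one_le_exp (by linarith [hy.1])
    have e2 : Real.exp (2 * (y + c)) ≤ 1 + 2 * k / B := by
      rw [← hexp]; exact Real.exp_le_exp.2 (by linarith [hy.2])
    have e3 : B / 2 - m ≤ wt B m (y + c) := by unfold wt; nlinarith
    have e4 : l * (1 + 2 * k / B) ≤ wt B m (y + c) ^ 2 := by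
      have s0 := Real.sqrt_nonneg l
      have s1 := Real.sq_sqrt hl
      have s2 : l / B ≤ √l := by
        rw [div_le_iff₀ hB0]
        have : √l ≤ B := by
          rw [Real.sqrt_le_left (by linarith)]; nlinarith
        nlinarith
      have s3 : l * (1 + 2 * k / B) = l + 2 * k * (l / B) := by ring
      nlinarith
    have e5 : l * Real.exp (2 * (y + c)) ≤ wt B m (y + c) ^ 2 :=
      le_trans (mul_le_mul_of_nonneg_left e2 hl) e4
    have e6 := mul_le_mul_of_nonneg_right e5 (sq_nonneg (f y))
    simp only [hH]
    nlinarith [sq_nonneg (f' y)]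
  have hi : ∀ p q : ℝ, IntervalIntegrable H volume p q := fun p q => hHc.intervalIntegrable p q
  have h5 : 0 ≤ ∫ y in a..0, H y := by
    have s1 := intervalIntegral.integral_add_adjacent_intervals (hi (a - c) a) (hi a (0 - c))
    have s2 := intervalIntegral.integral_add_adjacent_intervals (hi a (0 - c)) (hi (0 - c) 0)
    linarith
  have h6 : ∫ y in a..0, H y = radE B m a f f' + (2 * k *
      mom a f (fun x => Real.exp (2 * x) * wt B m x) +
      (k ^ 2 * mom a f (fun x => Real.exp (2 * x) ^ 2) - (l + 2 * k / B * l) * radN a f)) := by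
    unfold radE radN mom
    rw [← intervalIntegral.integral_const_mul, ← intervalIntegral.integral_const_mul,
      ← intervalIntegral.integral_const_mul, ← intervalIntegral.integral_sub
        (Continuous.intervalIntegrable (by fun_prop) _ _)
        (Continuous.intervalIntegrable (by fun_prop) _ _),
      ← intervalIntegral.integral_add (Continuous.intervalIntegrable (by fun_prop) _ _)
        (Continuous.intervalIntegrable (by fun_prop) _ _),
      ← intervalIntegral.integral_add (Continuous.intervalIntegrable (by fun_prop) _ _)
        (Continuous.intervalIntegrable (by fun_prop) _ _)]
    congr 1
    ext y
    have e1 : Real.exp (2 * (y + c)) = Real.exp (2 * y) * (1 + 2 * k / B) := by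
      rw [mul_add, Real.exp_add, hexp]
    have e2 : wt B m (y + c) = wt B m y + k * Real.exp (2 * y) := by
      unfold wt; rw [e1]; field_simp; ring
    simp only [hH, e1, e2]
    ring
  have h7 : mom a f (fun x => Real.exp (2 * x) ^ 2) ≤ radN a f := by
    refine mom_mono (by linarith) hc (by fun_prop) (by fun_prop) fun x hx => ?_
    have := exp_two_mul_le_one hx
    have := Real.exp_pos (2 * x)
    nlinarith
  nlinarith [mul_le_mul_of_nonneg_left h7 (sq_nonneg k)]

theorem one_sub_exp_bounds {t x : ℝ} (ht : 0 ≤ t) (ht1 : t ≤ 1) :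
    t * (1 - Real.exp (2 * x)) ≤ 1 - Real.exp (2 * t * x) ∧
      Real.exp (2 * x) * (1 - Real.exp (2 * t * x)) ≤ t * (1 - Real.exp (2 * x)) := by
  constructor
  · have := convexOn_exp.2 (mem_univ (0 : ℝ)) (mem_univ (2 * x)) (by linarith : 0 ≤ 1 - t) ht
      (by ring)
    simp only [smul_eq_mul, mul_zero, zero_add, Real.exp_zero, mul_one] at this
    have e : t * (2 * x) = 2 * t * x := by ring
    rw [e] at this
    linarith
  · have h1 := Real.add_one_le_exp (2 * t * x)
    have h2 := Real.add_one_le_exp (-(2 * x))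
    have h3 : Real.exp (2 * x) * Real.exp (-(2 * x)) = 1 := by rw [← Real.exp_add]; simp
    have h4 := Real.exp_pos (2 * x)
    have h5 : 1 - Real.exp (2 * t * x) ≤ t * (Real.exp (-(2 * x)) - 1) := by nlinarith
    nlinarith [mul_le_mul_of_nonneg_left h5 h4.le]

/-- Pointwise estimate for the change of the integrand under a logarithmic dilation. -/
theorem dilation_pointwise {B l t M : ℝ} (hB : 0 < B) (hl : 0 ≤ l) (ht : 0 ≤ t) (ht1 : t ≤ 1)
    {m : ℤ} (hM : |B / 2 - m| ≤ M) {x : ℝ} (hx : x ≤ 0) :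
    wt B m ((1 + t) * x) ^ 2 - l * Real.exp (2 * ((1 + t) * x)) ≤
      wt B m x ^ 2 - 2 * t * (wt B m x * (B / 2 - m - wt B m x)) + 4 * t * M ^ 3 / B
        + t ^ 2 * (B / 2 - m - wt B m x) ^ 2
        + l * (2 * t / B * (B / 2 - m - wt B m x) - Real.exp (2 * x)) := by
  obtain ⟨b1, b2⟩ := one_sub_exp_bounds (x := x) ht ht1
  have hz0 := Real.exp_pos (2 * x)
  have hz1 := exp_two_mul_le_one hx
  have e1 : Real.exp (2 * ((1 + t) * x)) = Real.exp (2 * x) * Real.exp (2 * t * x) := by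
    rw [← Real.exp_add]; ring_nf
  set z := Real.exp (2 * x) with hz
  set y := Real.exp (2 * t * x)
  set v := wt B m x with hv
  set T := B / 2 - m - v with hT
  have hTz : T = B / 2 * (1 - z) := by rw [hT, hv, wt]; ring
  set D := B / 2 * (z * (1 - y)) with hD
  have e2 : wt B m ((1 + t) * x) = v - D := by
    rw [wt, e1, hD, hv, wt]; ring
  have d1 : t * (z * T) ≤ D := by
    rw [hD, hTz]
    nlinarith [mul_le_mul_of_nonneg_left b1 (mul_nonneg hB.le hz0.le)]
  have d2 : D ≤ t * T := by
    rw [hD, hTz]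
    nlinarith [mul_le_mul_of_nonneg_left b2 hB.le]
  have hT0 : 0 ≤ T := by rw [hTz]; exact mul_nonneg (by linarith) (by linarith)
  have d0 : 0 ≤ D := le_trans (by positivity) d1
  have e3 : z * y = z - 2 / B * D := by rw [hD]; field_simp; ring
  have f1 : D ^ 2 ≤ t ^ 2 * T ^ 2 := by
    rw [← mul_pow]; exact pow_le_pow_left₀ d0 d2 2
  have f2 : l * (2 / B * D) ≤ l * (2 * t / B * T) := by
    refine mul_le_mul_of_nonneg_left ?_ hl
    have : 2 * t / B * T = 2 / B * (t * T) := by ring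
    rw [this]; exact mul_le_mul_of_nonneg_left d2 (by positivity)
  have hM0 : 0 ≤ M := le_trans (abs_nonneg _) hM
  have hMw : B / 2 - m ≤ M := le_trans (le_abs_self _) hM
  have f3 : -(v * D) ≤ -(t * (v * T)) + 2 * t * M ^ 3 / B := by
    have hr : 0 ≤ 2 * t * M ^ 3 / B := by positivity
    rcases le_or_gt v 0 with h | h
    · have := mul_le_mul_of_nonneg_left d2 (neg_nonneg.2 h)
      linarith
    · have g1 := mul_le_mul_of_nonneg_left d1 h.le
      have g2 : 1 - z = 2 / B * T := by rw [hTz]; field_simp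
      have hvM : v ≤ M := by linarith
      have hTM : T ≤ M := by linarith
      have g3 : v * T * T ≤ M ^ 3 := by
        have : v * T ≤ M * M := mul_le_mul hvM hTM hT0 hM0
        calc v * T * T ≤ M * M * M := mul_le_mul this hTM hT0 (by positivity)
          _ = M ^ 3 := by ring
      have g4 : v * (t * (z * T)) = t * (v * T) - t * (2 / B) * (v * T * T) := by
        have : z = 1 - 2 / B * T := by linarith
        rw [this]; ring
      have g5 : t * (2 / B) * (v * T * T) ≤ t * (2 / B) * M ^ 3 :=
        mul_le_mul_of_nonneg_left g3 (by positivity)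
      have g6 : t * (2 / B) * M ^ 3 = 2 * t * M ^ 3 / B := by ring
      linarith
  rw [e1, e2, e3]
  have : 4 * t * M ^ 3 / B = 2 * (2 * t * M ^ 3 / B) := by ring
  rw [this]
  have f4 : (v - D) ^ 2 = v ^ 2 + 2 * -(v * D) + D ^ 2 := by ring
  have f5 : l * (z - 2 / B * D) = l * z - l * (2 / B * D) := by ring
  have f6 : l * (2 * t / B * T - z) = l * (2 * t / B * T) - l * z := by ring
  rw [f4, f5, f6]
  linarith

/-- Virial inequality obtained by a logarithmic dilation fixing the boundary. -/
theorem log_dilation {B l e t M : ℝ} (hB : 0 < B) (hl : 0 ≤ l) (ht : 0 ≤ t) (ht1 : t ≤ 1)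
    (h : RadLB B l) {m : ℤ} {a : ℝ} {f f' : ℝ → ℝ}
    (hf : RadAdm a f f') (hE : radE B m a f f' ≤ l * radN a f + e) (hM : |B / 2 - m| ≤ M) :
    (1 - (1 / (1 + t)) ^ 2) * (∫ x in a..0, f' x ^ 2) ≤
      - 2 * t * ((B / 2 - m) * mom a f (wt B m) - mom a f (fun x => wt B m x ^ 2))
      + 4 * t * M ^ 3 / B * mom a f (fun _ => 1)
      + t ^ 2 * ((B / 2 - m) ^ 2 * mom a f (fun _ => 1) - 2 * (B / 2 - m) * mom a f (wt B m)
        + mom a f (fun x => wt B m x ^ 2))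
      + l * (2 * t / B) * ((B / 2 - m) * mom a f (fun _ => 1) - mom a f (wt B m)) + e := by
  have hc := hf.continuous
  have hc' := hf.cont
  have ha := hf.le_neg_one
  have ht' : 0 < 1 + t := by linarith
  have hg : RadAdm (a * (1 + t)) (fun x => f (x / (1 + t)))
      (fun x => f' (x / (1 + t)) / (1 + t)) := by
    refine ⟨by nlinarith, fun x => ?_, by fun_prop, fun x hx => hf.eq_zero _ ?_⟩
    · have := (hf.hasDerivAt (x / (1 + t))).comp x ((hasDerivAt_id x).div_const (1 + t))
      refine this.congr_deriv ?_
      ring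
    · rwa [div_le_iff₀ ht']
  have h1 := h m _ _ _ hg
  have eN : radN (a * (1 + t)) (fun x => f (x / (1 + t))) =
      (1 + t) * ∫ y in a..0, Real.exp (2 * ((1 + t) * y)) * f y ^ 2 := by
    have := intervalIntegral.integral_comp_div (a := a * (1 + t)) (b := 0)
      (fun y => Real.exp (2 * ((1 + t) * y)) * f y ^ 2) ht'.ne'
    simp only [zero_div, mul_div_cancel_right₀ _ ht'.ne', mul_div_cancel₀ _ ht'.ne',
      smul_eq_mul] at this
    exact this
  have eE : radE B m (a * (1 + t)) (fun x => f (x / (1 + t)))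
      (fun x => f' (x / (1 + t)) / (1 + t)) =
      (1 + t) * ∫ y in a..0, ((f' y / (1 + t)) ^ 2 + wt B m ((1 + t) * y) ^ 2 * f y ^ 2) := by
    have := intervalIntegral.integral_comp_div (a := a * (1 + t)) (b := 0)
      (fun y => (f' y / (1 + t)) ^ 2 + wt B m ((1 + t) * y) ^ 2 * f y ^ 2) ht'.ne'
    simp only [zero_div, mul_div_cancel_right₀ _ ht'.ne', mul_div_cancel₀ _ ht'.ne',
      smul_eq_mul] at this
    exact this
  have h2 : l * (∫ y in a..0, Real.exp (2 * ((1 + t) * y)) * f y ^ 2) ≤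
      ∫ y in a..0, ((f' y / (1 + t)) ^ 2 + wt B m ((1 + t) * y) ^ 2 * f y ^ 2) := by
    rw [eN, eE] at h1
    refine le_of_mul_le_mul_left ?_ ht'
    linarith
  have h3 : (∫ y in a..0, ((f' y / (1 + t)) ^ 2 + wt B m ((1 + t) * y) ^ 2 * f y ^ 2))
      - l * (∫ y in a..0, Real.exp (2 * ((1 + t) * y)) * f y ^ 2) =
      (1 / (1 + t)) ^ 2 * (∫ x in a..0, f' x ^ 2) + mom a f (fun x => wt B m ((1 + t) * x) ^ 2
        - l * Real.exp (2 * ((1 + t) * x))) := by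
    unfold mom
    rw [← intervalIntegral.integral_const_mul, ← intervalIntegral.integral_const_mul,
      ← intervalIntegral.integral_sub (Continuous.intervalIntegrable (by fun_prop) _ _)
        (Continuous.intervalIntegrable (by fun_prop) _ _),
      ← intervalIntegral.integral_add (Continuous.intervalIntegrable (by fun_prop) _ _)
        (Continuous.intervalIntegrable (by fun_prop) _ _)]
    congr 1; ext y; ring
  have h4 := mom_mono (a := a) (by linarith) hc
    (g := fun x => wt B m ((1 + t) * x) ^ 2 - l * Real.exp (2 * ((1 + t) * x)))
    (h := fun x => (4 * t * M ^ 3 / B + t ^ 2 * (B / 2 - m) ^ 2 + l * (2 * t / B) * (B / 2 - m)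
      + (-2 * t * (B / 2 - m) - 2 * t ^ 2 * (B / 2 - m) - l * (2 * t / B)) * wt B m x
      + (1 + 2 * t + t ^ 2) * wt B m x ^ 2) + -l * Real.exp (2 * x))
    (by fun_prop) (by fun_prop) fun x hx =>
      (dilation_pointwise hB hl ht ht1 hM hx).trans_eq (by ring)
  rw [mom_add hc (by fun_prop) (by fun_prop), mom_quad hc, mom_const_mul, ← radN_eq] at h4
  rw [radE_eq hc hf.cont] at hE
  linarith

set_option maxHeartbeats 1000000 in
/-- The numerical part of the argument for angular momenta close to `B / 2`. -/
theorem numeric_near_boundary {s l K P r o W w : ℝ} (hs : 10000 ≤ s) (hl : 0 ≤ l) (hlB : l ≤ s ^ 2)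
    (hK : 0 ≤ K) (ho : |2 * o| ≤ r + 1 / 2500) (hr : 1 ≤ r)
    (hN : s ^ 2 / 2 = o + (s ^ 2 / 2 - w) * r)
    (hW : s ^ 2 / 2 * W = P + (s ^ 2 / 2 - w) * o)
    (hE2 : K + P ≤ l + 1 / 2500) (hw : |w| ≤ s + 1)
    (hw2 : w ^ 2 ≤ K + P + s)
    (hU : s ^ 2 / 2 ≤ K + 1 / 4 * (P - 2 * w * o + w ^ 2 * r))
    (hV : (1 - (1 / (1 + 1 / 100)) ^ 2) * K ≤ - 2 * (1 / 100) * (w * o - P)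
      + 4 * (1 / 100) * (s + 1) ^ 3 / s ^ 2 * r
      + (1 / 100) ^ 2 * (w ^ 2 * r - 2 * w * o + P)
      + l * (2 * (1 / 100) / s ^ 2) * (w * r - o) + 1 / 2500) :
    1 / 100 ≤ W := by
  obtain ⟨ho1, ho2⟩ := abs_le.1 ho
  obtain ⟨hw0, hw1⟩ := abs_le.1 hw
  have hs2 : 0 < s ^ 2 := by positivity
  have hss : 10000 * s ≤ s ^ 2 := by nlinarith
  have hrs : (r - 1) * s ≤ 3 := by
    have h0 : w * r ≤ (s + 1) * r := mul_le_mul_of_nonneg_right hw1 (by linarith)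
    have h1 : r * (s ^ 2 - 2 * s - 3) ≤ s ^ 2 + 1 / 2500 := by linarith
    by_contra! hcon
    have h2 : (r - 1) * s * (s ^ 2 - 2 * s - 3) ≤ (2 * s + 3 + 1 / 2500) * s := by
      have := mul_le_mul_of_nonneg_right h1 (by linarith : 0 ≤ s)
      linarith
    have h3 : 3 * (s ^ 2 - 2 * s - 3) ≤ (r - 1) * s * (s ^ 2 - 2 * s - 3) :=
      mul_le_mul_of_nonneg_right hcon.le (by linarith)
    linarith
  have hr1 : r ≤ 1 + 1 / 1000 := by
    have := mul_le_mul_of_nonneg_left hs (by linarith : 0 ≤ r - 1)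
    linarith
  have hoa : |o| ≤ 51 / 100 := by rw [abs_le]; constructor <;> linarith
  have hwo : |w * o| ≤ 52 / 100 * s := by
    rw [abs_mul]
    calc |w| * |o| ≤ (s + 1) * (51 / 100) :=
          mul_le_mul hw hoa (abs_nonneg _) (by linarith)
      _ ≤ 52 / 100 * s := by linarith
  obtain ⟨hwo1, hwo2⟩ := abs_le.1 hwo
  have hww : w ^ 2 ≤ (s + 1) ^ 2 := by
    rw [← sq_abs w]; exact pow_le_pow_left₀ (abs_nonneg _) hw 2
  have hwr : w ^ 2 * r ≤ K + P + 5 * s := by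
    have h1 : w ^ 2 * (r - 1) ≤ (s + 1) ^ 2 * (r - 1) :=
      mul_le_mul_of_nonneg_right hww (by linarith)
    have h2 : (s + 1) ^ 2 * (r - 1) ≤ 4 * s := by
      have h3 := mul_le_mul_of_nonneg_left hrs (by linarith : 0 ≤ s + 2)
      linarith
    linarith
  have hKP : K + P ≤ s ^ 2 + 1 := by linarith
  have hV1 : 4 * (1 / 100) * (s + 1) ^ 3 / s ^ 2 * r ≤ 5 / 100 * s := by
    rw [div_mul_eq_mul_div, div_le_iff₀ hs2]
    have h1 : (s + 1) ^ 3 ≤ 11 / 10 * s ^ 3 := by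
      have h0 : s + 1 ≤ 10001 / 10000 * s := by linarith
      calc (s + 1) ^ 3 ≤ (10001 / 10000 * s) ^ 3 := pow_le_pow_left₀ (by linarith) h0 3
        _ = (10001 / 10000) ^ 3 * s ^ 3 := by ring
        _ ≤ 11 / 10 * s ^ 3 := mul_le_mul_of_nonneg_right (by norm_num) (by positivity)
    have h2 : (s + 1) ^ 3 * r ≤ 11 / 10 * s ^ 3 * (1 + 1 / 1000) :=
      mul_le_mul h1 hr1 (by linarith) (by positivity)
    have h3 : 0 < s ^ 3 := by positivity
    calc 4 * (1 / 100) * (s + 1) ^ 3 * r = 4 * (1 / 100) * ((s + 1) ^ 3 * r) := by ring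
      _ ≤ 4 * (1 / 100) * (11 / 10 * s ^ 3 * (1 + 1 / 1000)) := by linarith
      _ ≤ 5 / 100 * s ^ 3 := by linarith
      _ = 5 / 100 * s * s ^ 2 := by ring
  have hV2 : l * (2 * (1 / 100) / s ^ 2) * (w * r - o) ≤ 3 / 100 * s := by
    have h1 : l * (2 * (1 / 100) / s ^ 2) ≤ 2 / 100 := by
      rw [mul_div_assoc', div_le_iff₀ hs2]; linarith
    have h0 : 0 ≤ l * (2 * (1 / 100) / s ^ 2) := by positivity
    have h2 : w * r - o ≤ 15 / 10 * s := by
      have := mul_le_mul hw1 hr1 (by linarith) (by linarith : 0 ≤ s + 1)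
      linarith [(abs_le.1 hoa).1]
    calc l * (2 * (1 / 100) / s ^ 2) * (w * r - o)
        ≤ l * (2 * (1 / 100) / s ^ 2) * (15 / 10 * s) := mul_le_mul_of_nonneg_left h2 h0
      _ ≤ 2 / 100 * (15 / 10 * s) := mul_le_mul_of_nonneg_right h1 (by linarith)
      _ = 3 / 100 * s := by ring
  have hKle : K ≤ P + 4 / 100 * s ^ 2 + 8 * s := by
    have hk : 197 / 10000 * K ≤ (1 - (1 / (1 + 1 / 100)) ^ 2) * K :=
      mul_le_mul_of_nonneg_right (by norm_num) hK
    generalize 4 * (1 / 100) * (s + 1) ^ 3 / s ^ 2 * r = v1 at hV hV1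
    generalize l * (2 * (1 / 100) / s ^ 2) * (w * r - o) = v2 at hV hV2
    have hV' := hk.trans hV
    clear hV hk
    linarith
  have hPge : 2564 / 10000 * s ^ 2 ≤ P := by linarith
  have hm : |(s ^ 2 / 2 - w) * o| ≤ 2508 / 10000 * s ^ 2 := by
    have h1 : |s ^ 2 / 2 - w| ≤ 5002 / 10000 * s ^ 2 := by
      rw [abs_le]; constructor <;> linarith
    have h2 : |o| ≤ 5008 / 10000 := by rw [abs_le]; constructor <;> linarith
    rw [abs_mul]
    calc _ ≤ 5002 / 10000 * s ^ 2 * (5008 / 10000) :=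
          mul_le_mul h1 h2 (abs_nonneg _) (by positivity)
      _ ≤ _ := by linarith
  have hm1 := (abs_le.1 hm).1
  have : s ^ 2 / 2 * (1 / 100) ≤ s ^ 2 / 2 * W := by linarith
  exact le_of_mul_le_mul_left this (by positivity)

/-- For near-minimizing radial states, the derivative of the energy in `B` is bounded below. -/
theorem mom_exp_mul_wt_ge {B l : ℝ} (hB : 10 ^ 8 ≤ B) (hlB : l ≤ B) (h : RadLB B l) {m : ℤ}
    {a : ℝ} {f f' : ℝ → ℝ} (hf : RadAdm a f f') (hn : radN a f = 1)
    (hE : radE B m a f f' ≤ l + 1 / 2500) :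
    1 / 100 ≤ mom a f (fun x => Real.exp (2 * x) * wt B m x) := by
  have hc := hf.continuous
  have ha := hf.le_neg_one
  have ha0 : a ≤ 0 := by linarith
  have hB0 : 0 < B := by linarith
  have hE' : radE B m a f f' ≤ l * radN a f + 1 / 2500 := by rw [hn, mul_one]; exact hE
  have hK : 0 ≤ ∫ x in a..0, f' x ^ 2 := intervalIntegral.integral_nonneg ha0 fun x _ => sq_nonneg _
  have hr : 1 ≤ mom a f (fun _ => 1) := hn ▸ radN_le_mom_one ha0 hc
  have hlow := radE_ge (B := B) hB0 (m := m) hf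
  have hs2 : √B ^ 2 = B := Real.sq_sqrt hB0.le
  have hs : 10000 ≤ √B := by
    rw [Real.le_sqrt (by norm_num) hB0.le]; linarith
  have hEl := h m a f f' hf
  have ho := abs_mom_wt_le h hf hE'
  have hN := radN_mul hB0.ne' m (a := a) hc
  have hW := mom_exp_mul_wt hB0.ne' m (a := a) hc
  have hU := uncertainty (B := B) (m := m) hf
  rw [hn] at hlow hEl hN hU
  set s := √B with hsdef
  have hl : 12 / 100 * B ≤ l := by nlinarith
  have hl0 : 0 ≤ l := by linarith
  rcases le_or_gt (√l + 1 / 50) (B / 2 - m) with hm | hm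
  · have hA := boundary_dilation (by linarith) hl0 hlB (by norm_num) (by norm_num) h hf hE' hm
    rw [hn] at hA
    have : 2 * (1 / 50) / B * l * 1 = 1 / 25 * (l / B) := by ring
    have h12 : 12 / 100 ≤ l / B := by rw [le_div_iff₀ hB0]; exact hl
    rw [this] at hA
    linarith
  · have hsl : √l ≤ s := Real.sqrt_le_sqrt hlB
    have hsl2 := Real.sq_sqrt hl0
    have hsl0 := Real.sqrt_nonneg l
    rw [radE_eq hc hf.cont] at hE hEl hE'
    have hneg : B / 2 - m < 0 → (B / 2 - m) ^ 2 ≤ mom a f (fun x => wt B m x ^ 2) := by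
      intro hneg
      have h1 : mom a f (fun _ => (B / 2 - m) ^ 2 * 1) ≤ mom a f (fun x => wt B m x ^ 2) := by
        refine mom_mono ha0 hc (by fun_prop) (by fun_prop) fun x hx => ?_
        have := wt_le hB0.le m hx
        nlinarith
      rw [mom_const_mul] at h1
      nlinarith [sq_nonneg (B / 2 - m)]
    have hw2 : (B / 2 - m) ^ 2 ≤ (∫ x in a..0, f' x ^ 2) + mom a f (fun x => wt B m x ^ 2) + s := by
      rcases lt_or_ge (B / 2 - (m : ℝ)) 0 with h0 | h0
      · linarith [hneg h0]
      · have : (B / 2 - m) ^ 2 ≤ (√l + 1 / 50) ^ 2 := pow_le_pow_left₀ h0 hm.le 2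
        nlinarith
    have hw : |B / 2 - (m : ℝ)| ≤ s + 1 := by
      rw [abs_le]
      refine ⟨?_, by linarith⟩
      by_contra! hcon
      have := hneg (by linarith)
      nlinarith
    have hV := log_dilation hB0 hl0 (by norm_num : (0 : ℝ) ≤ 1 / 100) (by norm_num) h hf
      (by rw [radE_eq hc hf.cont]; exact hE') hw
    refine numeric_near_boundary hs hl0 (by rw [hs2]; exact hlB) hK ho hr ?_ ?_
      (by linarith) hw hw2 ?_ ?_
    · rw [hs2]; linarith
    · rw [hs2]; linarith
    · rw [hs2]; linarith
    · rw [hs2]; exact hV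

/-- Monotonicity step for radial lower bounds under a small increase of the field. -/
theorem radE_le_of_field_le {B B' l : ℝ} (hB : 10 ^ 8 ≤ B') (hBB : B ≤ B') (hd : B' - B ≤ 1 / 100)
    (hl : l ≤ B') (h : RadLB B' l) {m : ℤ} {a : ℝ} {f f' : ℝ → ℝ} (hf : RadAdm a f f')
    (hn : radN a f = 1) (hE : radE B' m a f f' ≤ l + 1 / 2500) :
    radE B m a f f' ≤ radE B' m a f f' := by
  have hc := hf.continuous
  have ha0 : a ≤ 0 := by linarith [hf.le_neg_one]
  have hW := mom_exp_mul_wt_ge hB hl h hf hn hE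
  have h1 : mom a f (fun x => wt B m x ^ 2) ≤ mom a f (fun x => wt B' m x ^ 2
      + (-(B' - B) * (Real.exp (2 * x) * wt B' m x) + (B' - B) ^ 2 / 4 * Real.exp (2 * x))) := by
    refine mom_mono ha0 hc (by fun_prop) (by fun_prop) fun x hx => ?_
    have e : wt B m x = wt B' m x - (B' - B) / 2 * Real.exp (2 * x) := by unfold wt; ring
    have hz := exp_two_mul_le_one hx
    have hz0 := Real.exp_pos (2 * x)
    have : Real.exp (2 * x) ^ 2 ≤ Real.exp (2 * x) := by nlinarith
    rw [e]
    nlinarith [mul_le_mul_of_nonneg_left this (sq_nonneg (B' - B))]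
  rw [mom_add hc (by fun_prop) (by fun_prop), mom_add hc (by fun_prop) (by fun_prop),
    mom_const_mul, mom_const_mul, ← radN_eq, hn] at h1
  rw [radE_eq hc hf.cont, radE_eq hc hf.cont]
  nlinarith

theorem add_sq_le_weighted {k : ℝ} (hk : 0 < k) (x y : ℝ) :
    (x + y) ^ 2 ≤ (1 + k) * x ^ 2 + (1 + 1 / k) * y ^ 2 := by
  have h : (1 + k) * x ^ 2 + (1 + 1 / k) * y ^ 2 - (x + y) ^ 2 = (k * x - y) ^ 2 / k := by
    field_simp; ring
  have : 0 ≤ (k * x - y) ^ 2 / k := by positivity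
  linarith

/-- A logarithmic cutoff turns a bounded radial function of small energy into an admissible one. -/
theorem exists_radAdm_lt {B Λ q M L₀ : ℝ} {m : ℤ} {f f' : ℝ → ℝ}
    (hf : ∀ x, HasDerivAt f (f' x) x) (hf' : Continuous f') (hM : ∀ x ≤ 0, |f x| ≤ M)
    (hL₀ : 0 ≤ L₀) (hΛ : 0 ≤ Λ) (hq : ∀ L ≥ L₀, radE B m (-L) f f' ≤ q)
    (hn : q < Λ * radN (-L₀) f) :
    ∃ a g g', RadAdm a g g' ∧ radE B m a g g' < Λ * radN a g := by
  have hc : Continuous f := continuous_iff_continuousAt.2 fun x => (hf x).continuousAt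
  have hS : ContDiff ℝ 1 Real.smoothTransition := Real.smoothTransition.contDiff
  have hSd : ∀ x, HasDerivAt Real.smoothTransition (deriv Real.smoothTransition x) x := fun x =>
    (hS.differentiable one_ne_zero x).hasDerivAt
  have hSc : Continuous (deriv Real.smoothTransition) := hS.continuous_deriv le_rfl
  have hSc' : Continuous Real.smoothTransition := hS.continuous
  obtain ⟨C, hC⟩ := (isCompact_Icc (a := (0 : ℝ)) (b := 2)).exists_bound_of_continuousOn
    hSc.continuousOn
  have hlim : Tendsto (fun k : ℝ => (1 + 1 / k) * q + (1 / k + 1) * (1 / k) * (2 * C ^ 2 * M ^ 2))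
      atTop (𝓝 ((1 + 0) * q + (0 + 1) * 0 * (2 * C ^ 2 * M ^ 2))) := by
    have h0 : Tendsto (fun k : ℝ => 1 / k) atTop (𝓝 0) := by
      simpa only [one_div] using tendsto_inv_atTop_zero
    exact (((h0.const_add 1).mul_const q).add (((h0.add_const 1).mul h0).mul_const _))
  have hev := (hlim.eventually_lt_const (by simpa using hn)).and
    ((eventually_ge_atTop L₀).and (eventually_ge_atTop 1))
  obtain ⟨k, hk1, hk2, hk3⟩ := hev.exists
  have hk0 : 0 < k := by linarith
  have hL1 : 1 ≤ k ^ 2 := by nlinarith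
  have hLk : k ≤ k ^ 2 := by nlinarith
  have hk2p : 0 < k ^ 2 := by positivity
  set χ : ℝ → ℝ := fun x => Real.smoothTransition (x / k ^ 2 + 2) with hχ
  set χ' : ℝ → ℝ := fun x => deriv Real.smoothTransition (x / k ^ 2 + 2) / k ^ 2 with hχ'
  have hχc : Continuous χ := by fun_prop
  have hχc' : Continuous χ' := by fun_prop
  have hχd : ∀ x, HasDerivAt χ (χ' x) x := fun x => by
    have h1 : HasDerivAt (fun x : ℝ => x / k ^ 2 + 2) (1 / k ^ 2) x :=
      ((hasDerivAt_id x).div_const _).add_const _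
    have := (hSd (x / k ^ 2 + 2)).comp x h1
    rw [mul_one_div] at this
    exact this
  have hg : RadAdm (-(2 * k ^ 2)) (fun x => χ x * f x) (fun x => χ' x * f x + χ x * f' x) := by
    refine ⟨by linarith, fun x => (hχd x).mul (hf x), by fun_prop, fun x hx => ?_⟩
    have : x / k ^ 2 + 2 ≤ 0 := by
      have : x / k ^ 2 ≤ -2 := by rw [div_le_iff₀ hk2p]; linarith
      linarith
    simp [hχ, Real.smoothTransition.zero_of_nonpos this]
  refine ⟨_, _, _, hg, ?_⟩
  have hE : radE B m (-(2 * k ^ 2)) (fun x => χ x * f x) (fun x => χ' x * f x + χ x * f' x) ≤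
      (1 + 1 / k) * radE B m (-(2 * k ^ 2)) f f' + (1 / k + 1) * (1 / k) * (2 * C ^ 2 * M ^ 2) := by
    have h1 : radE B m (-(2 * k ^ 2)) (fun x => χ x * f x) (fun x => χ' x * f x + χ x * f' x) ≤
        ∫ x in (-(2 * k ^ 2))..0, ((1 + 1 / k) * (f' x ^ 2 + wt B m x ^ 2 * f x ^ 2) +
          (1 + k) * (C ^ 2 * M ^ 2 / k ^ 4)) := by
      refine intervalIntegral.integral_mono_on (by linarith)
        (Continuous.intervalIntegrable (by fun_prop) _ _)
        (Continuous.intervalIntegrable (by fun_prop) _ _) fun x hx => ?_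
      have hmem : x / k ^ 2 + 2 ∈ Icc (0 : ℝ) 2 := by
        have h1 : -2 ≤ x / k ^ 2 := by rw [le_div_iff₀ hk2p]; linarith [hx.1]
        have h2 : x / k ^ 2 ≤ 0 := div_nonpos_of_nonpos_of_nonneg hx.2 hk2p.le
        constructor <;> linarith
      have hχ0 : 0 ≤ χ x := Real.smoothTransition.nonneg _
      have hχ1 : χ x ^ 2 ≤ 1 := pow_le_one₀ hχ0 (Real.smoothTransition.le_one _)
      have hb := hC _ hmem
      rw [Real.norm_eq_abs] at hb
      have hb2 : χ' x ^ 2 * f x ^ 2 ≤ C ^ 2 * M ^ 2 / k ^ 4 := by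
        have e1 : χ' x ^ 2 = deriv Real.smoothTransition (x / k ^ 2 + 2) ^ 2 / k ^ 4 := by
          simp only [hχ', div_pow]; ring
        have e2 : deriv Real.smoothTransition (x / k ^ 2 + 2) ^ 2 ≤ C ^ 2 := by
          rw [← sq_abs]; exact pow_le_pow_left₀ (abs_nonneg _) hb 2
        have e3 : f x ^ 2 ≤ M ^ 2 := by
          rw [← sq_abs]; exact pow_le_pow_left₀ (abs_nonneg _) (hM x hx.2) 2
        rw [e1, div_mul_eq_mul_div]
        gcongr
      have hw := add_sq_le_weighted hk0 (χ' x * f x) (χ x * f' x)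
      have t1 : (1 + k) * (χ' x * f x) ^ 2 ≤ (1 + k) * (C ^ 2 * M ^ 2 / k ^ 4) := by
        rw [mul_pow]; exact mul_le_mul_of_nonneg_left hb2 (by linarith)
      have hk1' : 0 < 1 / k := by positivity
      have t2 : (1 + 1 / k) * (χ x * f' x) ^ 2 ≤ (1 + 1 / k) * f' x ^ 2 := by
        rw [mul_pow]
        exact mul_le_mul_of_nonneg_left (mul_le_of_le_one_left (sq_nonneg _) hχ1) (by linarith)
      have t3 : wt B m x ^ 2 * (χ x * f x) ^ 2 ≤ (1 + 1 / k) * (wt B m x ^ 2 * f x ^ 2) := by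
        have : wt B m x ^ 2 * (χ x * f x) ^ 2 = χ x ^ 2 * (wt B m x ^ 2 * f x ^ 2) := by ring
        rw [this]
        exact mul_le_mul_of_nonneg_right (by linarith) (by positivity)
      linarith
    rw [intervalIntegral.integral_add (Continuous.intervalIntegrable (by fun_prop) _ _)
      (Continuous.intervalIntegrable (by fun_prop) _ _), intervalIntegral.integral_const_mul,
      intervalIntegral.integral_const, smul_eq_mul] at h1
    refine h1.trans_eq ?_
    unfold radE
    congr 1
    field_simp; ring
  have hE2 := hq (2 * k ^ 2) (by linarith)
  have hN : radN (-L₀) f ≤ radN (-(2 * k ^ 2)) (fun x => χ x * f x) := by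
    have h1 : radN (-L₀) f = radN (-L₀) (fun x => χ x * f x) := by
      refine intervalIntegral.integral_congr fun x hx => ?_
      rw [uIcc_of_le (by linarith)] at hx
      have : 1 ≤ x / k ^ 2 + 2 := by
        have : -1 ≤ x / k ^ 2 := by rw [le_div_iff₀ hk2p]; linarith [hx.1]
        linarith
      simp [hχ, Real.smoothTransition.one_of_one_le this]
    rw [h1]
    refine intervalIntegral.integral_mono_interval (by linarith) (by linarith) le_rfl
      (Eventually.of_forall fun x => by positivity)
      (Continuous.intervalIntegrable (by fun_prop) _ _)
  have hk1' : 0 < 1 / k := by positivity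
  calc _ ≤ _ := hE
    _ ≤ (1 + 1 / k) * q + (1 / k + 1) * (1 / k) * (2 * C ^ 2 * M ^ 2) := by gcongr
    _ < Λ * radN (-L₀) f := hk1
    _ ≤ _ := mul_le_mul_of_nonneg_left hN hΛ

/-- The Gaussian trial state shows that radial lower bounds never exceed the field strength. -/
theorem RadLB.le_field {B l : ℝ} (hB : 0 < B) (h : RadLB B l) : l ≤ B := by
  set f : ℝ → ℝ := fun x => Real.exp (-(B / 4) * Real.exp (2 * x)) with hfdef
  have he : ∀ x : ℝ, HasDerivAt (fun x : ℝ => Real.exp (2 * x)) (2 * Real.exp (2 * x)) x :=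
    fun x => (((hasDerivAt_id x).const_mul 2).exp).congr_deriv (by simp [mul_comm])
  have hfd : ∀ x, HasDerivAt f (-(B / 2) * Real.exp (2 * x) * f x) x := fun x =>
    (((he x).const_mul (-(B / 4))).exp).congr_deriv (by simp only [hfdef]; ring)
  have hfc : Continuous f := by fun_prop
  have hfd2 : ∀ x, HasDerivAt (fun y => f y ^ 2) (-B * Real.exp (2 * x) * f x ^ 2) x := fun x =>
    ((hfd x).pow 2).congr_deriv (by ring)
  have hf1 : ∀ x, f x ^ 2 = Real.exp (-(B / 2) * Real.exp (2 * x)) := fun x => by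
    simp only [hfdef]; rw [← Real.exp_nat_mul]; congr 1; push_cast; ring
  have hN : ∀ L, B * radN (-L) f = f (-L) ^ 2 - f 0 ^ 2 := fun L => by
    have := intervalIntegral.integral_eq_sub_of_hasDerivAt (a := -L) (b := 0)
      (fun x _ => hfd2 x) (Continuous.intervalIntegrable (by fun_prop) _ _)
    have e : ∀ x, -B * Real.exp (2 * x) * f x ^ 2 = -B * (Real.exp (2 * x) * f x ^ 2) :=
      fun x => by ring
    simp only [e, intervalIntegral.integral_const_mul] at this
    unfold radN; linarith
  have hE : ∀ L, radE B 0 (-L) f (fun x => -(B / 2) * Real.exp (2 * x) * f x) =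
      B * radN (-L) f - (B / 2 * f 0 ^ 2 - B / 2 * (Real.exp (2 * -L) * f (-L) ^ 2)) := fun L => by
    have hd : ∀ x, HasDerivAt (fun y => B / 2 * (Real.exp (2 * y) * f y ^ 2)) (B / 2 *
        (2 * Real.exp (2 * x) * f x ^ 2 + Real.exp (2 * x) * (-B * Real.exp (2 * x) * f x ^ 2))) x :=
      fun x => ((he x).mul (hfd2 x)).const_mul (B / 2)
    have := intervalIntegral.integral_eq_sub_of_hasDerivAt (a := -L) (b := 0)
      (fun x _ => hd x) (Continuous.intervalIntegrable (by fun_prop) _ _)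
    simp only [mul_zero, Real.exp_zero, one_mul] at this
    rw [← this]
    unfold radE radN
    rw [← intervalIntegral.integral_const_mul, ← intervalIntegral.integral_sub
      (Continuous.intervalIntegrable (by fun_prop) _ _)
      (Continuous.intervalIntegrable (by fun_prop) _ _)]
    refine intervalIntegral.integral_congr fun x _ => ?_
    simp only [wt]; push_cast; ring
  have hup : ∀ x, f x ^ 2 ≤ 1 := fun x => by
    rw [hf1]; exact Real.exp_le_one_iff.2 (by nlinarith [Real.exp_pos (2 * x)])
  set L₀ := B / 4 + 1 with hL₀
  obtain ⟨a, g, g', hg, hlt⟩ := exists_radAdm_lt (B := B) (Λ := B) (m := 0) (M := 1) (L₀ := L₀)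
    (q := 1 - f 0 ^ 2 - B / 2 * f 0 ^ 2 + B / 2 * Real.exp (2 * -L₀)) hfd (by fun_prop)
    (fun x _ => by
      rw [abs_of_pos (Real.exp_pos _)]
      exact Real.exp_le_one_iff.2 (by nlinarith [Real.exp_pos (2 * x)]))
    (by positivity) hB.le (fun L hL => by
      rw [hE, hN]
      have h1 : Real.exp (2 * -L) * f (-L) ^ 2 ≤ Real.exp (2 * -L₀) * 1 :=
        mul_le_mul (Real.exp_le_exp.2 (by linarith)) (hup _) (sq_nonneg _) (Real.exp_pos _).le
      have := mul_le_mul_of_nonneg_left h1 (by linarith : 0 ≤ B / 2)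
      linarith [hup (-L)]) (by
      rw [hN]
      have h1 : 1 - B / 2 * Real.exp (2 * -L₀) ≤ f (-L₀) ^ 2 := by
        rw [hf1]
        linarith [Real.add_one_le_exp (-(B / 2) * Real.exp (2 * -L₀))]
      have h2 : Real.exp (2 * -L₀) < 1 / 2 * f 0 ^ 2 := by
        rw [hf1]
        have e1 : 2 * -L₀ = -2 + -(B / 2) * Real.exp (2 * 0) := by
          rw [hL₀, mul_zero, Real.exp_zero]; ring
        rw [e1, Real.exp_add]
        refine mul_lt_mul_of_pos_right ?_ (Real.exp_pos _)
        rw [Real.exp_neg, one_div]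
        refine inv_strictAnti₀ (by norm_num) ?_
        linarith [Real.add_one_le_exp (2 : ℝ)]
      have h3 := mul_lt_mul_of_pos_left h2 hB
      linarith)
  have h1 := h 0 a g g' hg
  by_contra! hcon
  have hN0 : 0 ≤ radN a g := intervalIntegral.integral_nonneg (by linarith [hg.le_neg_one])
    fun x _ => by positivity
  nlinarith

/-- Logarithmic polar coordinates. -/
def logPolar (x θ : ℝ) : Plane := (Real.exp x * Real.cos θ, Real.exp x * Real.sin θ)

/-- The angular direction at a point of the plane. -/
def rot (p : Plane) : Plane := (-p.2, p.1)

@[fun_prop]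
theorem continuous_logPolar : Continuous fun p : ℝ × ℝ => logPolar p.1 p.2 := by
  unfold logPolar; fun_prop

@[fun_prop]
theorem continuous_rot : Continuous rot := by unfold rot; fun_prop

theorem esq_logPolar (x θ : ℝ) : esq (logPolar x θ) = Real.exp (2 * x) := by
  have : Real.exp (2 * x) = Real.exp x ^ 2 := by rw [← Real.exp_nat_mul]; norm_cast
  rw [this]
  simp only [esq, logPolar]
  linear_combination Real.exp x ^ 2 * Real.sin_sq_add_cos_sq θ

theorem logPolar_mem_unitDisc {x θ : ℝ} : logPolar x θ ∈ unitDisc ↔ x < 0 := by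
  change esq (logPolar x θ) < 1 ↔ x < 0
  rw [esq_logPolar, Real.exp_lt_one_iff]
  constructor <;> intro h <;> linarith

theorem isOpen_unitDisc : IsOpen unitDisc :=
  isOpen_lt (by fun_prop) continuous_const

theorem hasDerivAt_logPolar_left (x θ : ℝ) :
    HasDerivAt (fun y => logPolar y θ) (logPolar x θ) x :=
  ((Real.hasDerivAt_exp x).mul_const _).prodMk ((Real.hasDerivAt_exp x).mul_const _)

theorem hasDerivAt_logPolar_right (x θ : ℝ) :
    HasDerivAt (logPolar x) (rot (logPolar x θ)) θ := by
  refine ((Real.hasDerivAt_cos θ).const_mul _).prodMk ((Real.hasDerivAt_sin θ).const_mul _)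
    |>.congr_deriv ?_
  simp [rot, logPolar]

/-- The magnetic energy density in terms of the radial and the angular derivative. -/
theorem esq_mul_magSq (B : ℝ) (u : Plane → ℂ) (p : Plane) :
    esq p * magSq B F0 u p = ‖fderiv ℝ u p p‖ ^ 2 +
      ‖(-Complex.I) * fderiv ℝ u p (rot p) - ((B / 2 * esq p : ℝ) : ℂ) * u p‖ ^ 2 := by
  obtain ⟨r, s⟩ := p
  have e1 : ((r, s) : Plane) = r • ((1 : ℝ), (0 : ℝ)) + s • ((0 : ℝ), (1 : ℝ)) := by simp
  have e2 : rot (r, s) = (-s) • ((1 : ℝ), (0 : ℝ)) + r • ((0 : ℝ), (1 : ℝ)) := by simp [rot]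
  have h1 : fderiv ℝ u (r, s) (r, s) =
      r * fderiv ℝ u (r, s) ((1 : ℝ), (0 : ℝ)) + s * fderiv ℝ u (r, s) ((0 : ℝ), (1 : ℝ)) := by
    conv_lhs => arg 2; rw [e1]
    rw [map_add, map_smul, map_smul]; simp
  have h2 : fderiv ℝ u (r, s) (rot (r, s)) =
      -s * fderiv ℝ u (r, s) ((1 : ℝ), (0 : ℝ)) + r * fderiv ℝ u (r, s) ((0 : ℝ), (1 : ℝ)) := by
    rw [e2, map_add, map_smul, map_smul]; simp
  rw [h1, h2]
  unfold magSq
  generalize fderiv ℝ u (r, s) ((1 : ℝ), (0 : ℝ)) = α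
  generalize fderiv ℝ u (r, s) ((0 : ℝ), (1 : ℝ)) = β
  generalize u (r, s) = w
  simp only [← Complex.normSq_eq_norm_sq, Complex.normSq_apply, esq, F0]
  simp [pow_two]
  ring

theorem lintegral_unitDisc {g : Plane → ENNReal} (hg : Measurable g) :
    ∫⁻ p in unitDisc, g p = ∫⁻ x in Iio (0 : ℝ), ∫⁻ θ in Ioo (-Real.pi) Real.pi,
      ENNReal.ofReal (Real.exp (2 * x)) * g (logPolar x θ) := by
  have hG : Measurable (unitDisc.indicator g) := hg.indicator isOpen_unitDisc.measurableSet
  have hsymm : Measurable fun p : ℝ × ℝ => polarCoord.symm p :=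
    continuous_polarCoord_symm.measurable
  rw [← lintegral_indicator isOpen_unitDisc.measurableSet, ← lintegral_comp_polarCoord_symm,
    polarCoord_target, Measure.volume_eq_prod, ← Measure.prod_restrict,
    lintegral_prod _ (by
      simp only [smul_eq_mul]
      exact ((measurable_fst.ennreal_ofReal).mul (hG.comp hsymm)).aemeasurable),
    ← Real.range_exp, ← image_univ,
    lintegral_image_eq_lintegral_abs_deriv_mul MeasurableSet.univ
      (fun x _ => (Real.hasDerivAt_exp x).hasDerivWithinAt) Real.exp_injective.injOn,
    ← lintegral_indicator MeasurableSet.univ, ← lintegral_indicator measurableSet_Iio]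
  congr 1
  ext x
  rw [indicator_univ]
  have e : ∀ θ, polarCoord.symm (Real.exp x, θ) = logPolar x θ := fun θ => rfl
  have hexp : ENNReal.ofReal (Real.exp (2 * x)) =
      ENNReal.ofReal (Real.exp x) * ENNReal.ofReal (Real.exp x) := by
    rw [← ENNReal.ofReal_mul (Real.exp_pos x).le, ← Real.exp_add]; ring_nf
  rw [abs_of_pos (Real.exp_pos x), ← lintegral_const_mul' _ _ ENNReal.ofReal_ne_top]
  by_cases hx : x < 0
  · rw [indicator_of_mem (mem_Iio.2 hx)]
    refine lintegral_congr fun θ => ?_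
    rw [e, indicator_of_mem (logPolar_mem_unitDisc.2 hx), hexp, smul_eq_mul, mul_assoc]
  · rw [indicator_of_notMem (by simpa using hx)]
    have : ∀ θ, unitDisc.indicator g (polarCoord.symm (Real.exp x, θ)) = 0 := fun θ => by
      rw [e, indicator_of_notMem]
      rwa [logPolar_mem_unitDisc]
    simp only [this, smul_zero, mul_zero, lintegral_zero]

theorem hasDerivAt_intervalIntegral_of_continuous {a b : ℝ} {G G' : ℝ → ℝ → ℂ}
    (hG : Continuous (Function.uncurry G)) (hG' : Continuous (Function.uncurry G'))
    (h : ∀ x θ, HasDerivAt (fun y => G y θ) (G' x θ) x) (x : ℝ) :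
    HasDerivAt (fun y => ∫ θ in a..b, G y θ) (∫ θ in a..b, G' x θ) x := by
  obtain ⟨C, hC⟩ := ((isCompact_Icc (a := x - 1) (b := x + 1)).prod
    (isCompact_uIcc (a := a) (b := b))).exists_bound_of_continuousOn hG'.continuousOn
  have hGx : ∀ y, Continuous (G y) := fun y => hG.comp (by fun_prop : Continuous fun θ => (y, θ))
  have hGx' : ∀ y, Continuous (G' y) := fun y =>
    hG'.comp (by fun_prop : Continuous fun θ => (y, θ))
  refine (intervalIntegral.hasDerivAt_integral_of_dominated_loc_of_deriv_le
    (s := Icc (x - 1) (x + 1)) (bound := fun _ => C)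
    (Icc_mem_nhds (by linarith) (by linarith))
    (Eventually.of_forall fun y => (hGx y).aestronglyMeasurable)
    ((hGx x).intervalIntegrable _ _) (hGx' x).aestronglyMeasurable
    (Eventually.of_forall fun θ hθ y hy => hC (y, θ) ⟨hy, uIoc_subset_uIcc hθ⟩)
    intervalIntegrable_const (Eventually.of_forall fun θ _ y _ => h y θ)).2

/-- The Fourier coefficient of a function of the angle in `[-π, π]`. -/
def angCoeff (m : ℤ) (g : ℝ → ℂ) : ℂ :=
  (1 / (2 * Real.pi) : ℝ) • ∫ θ in (-Real.pi)..Real.pi, Complex.exp (-(m * θ * Complex.I)) * g θ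

theorem fourierCoeffOn_eq_angCoeff (m : ℤ) (g : ℝ → ℂ) :
    fourierCoeffOn (neg_lt_self Real.pi_pos) g m = angCoeff m g := by
  rw [fourierCoeffOn_eq_integral, angCoeff]
  have h : Real.pi - -Real.pi = 2 * Real.pi := by ring
  rw [h]
  congr 1
  refine intervalIntegral.integral_congr fun θ _ => ?_
  simp only [fourier_coe_apply, smul_eq_mul]
  congr 2
  have := Complex.ofReal_ne_zero.2 Real.pi_ne_zero
  push_cast
  field_simp

theorem angCoeff_const_mul (m : ℤ) (c : ℂ) (g : ℝ → ℂ) :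
    angCoeff m (fun θ => c * g θ) = c * angCoeff m g := by
  rw [← fourierCoeffOn_eq_angCoeff, ← fourierCoeffOn_eq_angCoeff, fourierCoeffOn.const_mul]

theorem angCoeff_sub (m : ℤ) {g h : ℝ → ℂ} (hg : Continuous g) (hh : Continuous h) :
    angCoeff m (fun θ => g θ - h θ) = angCoeff m g - angCoeff m h := by
  simp only [angCoeff, mul_sub]
  rw [intervalIntegral.integral_sub (Continuous.intervalIntegrable (by fun_prop) _ _)
    (Continuous.intervalIntegrable (by fun_prop) _ _), smul_sub]

theorem angCoeff_deriv (m : ℤ) {g g' : ℝ → ℂ} (hg : ∀ θ, HasDerivAt g (g' θ) θ)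
    (hg' : Continuous g') (hper : g (-Real.pi) = g Real.pi) :
    angCoeff m g' = Complex.I * m * angCoeff m g := by
  have hgc : Continuous g := continuous_iff_continuousAt.2 fun θ => (hg θ).continuousAt
  have he : ∀ θ : ℝ, HasDerivAt (fun θ : ℝ => Complex.exp (-(m * θ * Complex.I)))
      (-(m * Complex.I) * Complex.exp (-(m * θ * Complex.I))) θ := fun θ => by
    have h1 : HasDerivAt (fun θ : ℝ => -(m * (θ : ℂ) * Complex.I)) (-(m * 1 * Complex.I)) θ :=
      (((hasDerivAt_id θ).ofReal_comp.const_mul (m : ℂ)).mul_const Complex.I).neg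
    exact h1.cexp.congr_deriv (by ring)
  have h := intervalIntegral.integral_eq_sub_of_hasDerivAt (a := -Real.pi) (b := Real.pi)
    (fun θ _ => (he θ).mul (hg θ)) (Continuous.intervalIntegrable (by fun_prop) _ _)
  have hexp : Complex.exp (-(m * (Real.pi : ℂ) * Complex.I)) =
      Complex.exp (-(m * ((-Real.pi : ℝ) : ℂ) * Complex.I)) := by
    rw [Complex.exp_eq_exp_iff_exists_int]
    exact ⟨-m, by push_cast; ring⟩
  simp only [Pi.mul_apply] at h
  rw [hper, hexp, sub_self, intervalIntegral.integral_add
    (Continuous.intervalIntegrable (by fun_prop) _ _)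
    (Continuous.intervalIntegrable (by fun_prop) _ _)] at h
  simp only [mul_assoc, intervalIntegral.integral_const_mul] at h
  simp only [angCoeff, Complex.real_smul, mul_assoc] at h ⊢
  rw [eq_neg_of_add_eq_zero_right h]
  ring

/-- Parseval's identity in the angular variable. -/
theorem lintegral_norm_sq_eq_tsum {g : ℝ → ℂ} (hg : Continuous g) :
    ∫⁻ θ in Ioo (-Real.pi) Real.pi, ENNReal.ofReal (‖g θ‖ ^ 2) =
      ENNReal.ofReal (2 * Real.pi) * ∑' m : ℤ, ENNReal.ofReal (‖angCoeff m g‖ ^ 2) := by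
  have hpi : -Real.pi < Real.pi := neg_lt_self Real.pi_pos
  have hL2 : MemLp g 2 (volume.restrict (Ioc (-Real.pi) Real.pi)) := by
    obtain ⟨C, hC⟩ := (isCompact_Icc (a := -Real.pi) (b := Real.pi)).exists_bound_of_continuousOn
      hg.continuousOn
    refine MemLp.of_bound hg.aestronglyMeasurable C ?_
    filter_upwards [ae_restrict_mem measurableSet_Ioc] with θ hθ
    exact hC θ (Ioc_subset_Icc_self hθ)
  have h := hasSum_sq_fourierCoeffOn hpi hL2
  simp only [fourierCoeffOn_eq_angCoeff, smul_eq_mul] at h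
  rw [← ENNReal.ofReal_tsum_of_nonneg (fun m => sq_nonneg _) h.summable, h.tsum_eq,
    ← ENNReal.ofReal_mul (by positivity), Measure.restrict_congr_set Ioo_ae_eq_Ioc,
    ← ofReal_integral_eq_lintegral_ofReal, ← intervalIntegral.integral_of_le hpi.le]
  · congr 1
    have := Real.pi_pos.ne'
    field_simp
    ring
  · exact ((by fun_prop : Continuous fun θ => ‖g θ‖ ^ 2).integrableOn_Icc).mono_set
      Ioc_subset_Icc_self
  · exact Eventually.of_forall fun θ => sq_nonneg _

/-- The angular momentum `m` component of `v`, in the logarithmic radial variable. -/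
def sector (m : ℤ) (v : Plane → ℂ) (x : ℝ) : ℂ := angCoeff m fun θ => v (logPolar x θ)

/-- The derivative of `sector m v`. -/
def sectorDeriv (m : ℤ) (v : Plane → ℂ) (x : ℝ) : ℂ :=
  angCoeff m fun θ => fderiv ℝ v (logPolar x θ) (logPolar x θ)

theorem continuous_angCoeff (m : ℤ) {G : ℝ → ℝ → ℂ} (hG : Continuous (Function.uncurry G)) :
    Continuous fun x => angCoeff m (G x) := by
  refine Continuous.const_smul (c := (1 / (2 * Real.pi) : ℝ)) ?_
  refine intervalIntegral.continuous_parametric_intervalIntegral_of_continuous' ?_ _ _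
  exact (by fun_prop : Continuous fun p : ℝ × ℝ => Complex.exp (-(m * p.2 * Complex.I))).mul hG

theorem norm_angCoeff_le (m : ℤ) {g : ℝ → ℂ} {M : ℝ} (hg : ∀ θ, ‖g θ‖ ≤ M) :
    ‖angCoeff m g‖ ≤ M := by
  have h := intervalIntegral.norm_integral_le_of_norm_le_const (a := -Real.pi) (b := Real.pi)
    (f := fun θ => Complex.exp (-(m * θ * Complex.I)) * g θ) (C := M) fun θ _ => by
      have : -(m * (θ : ℂ) * Complex.I) = ((-(m * θ) : ℝ) : ℂ) * Complex.I := by push_cast; ring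
      rw [norm_mul, this, Complex.norm_exp_ofReal_mul_I, one_mul]
      exact hg θ
  have hp := Real.pi_pos
  have e : Real.pi - -Real.pi = 2 * Real.pi := by ring
  rw [e, abs_of_pos (by positivity)] at h
  rw [angCoeff, norm_smul, Real.norm_eq_abs, abs_of_pos (by positivity), one_div,
    inv_mul_le_iff₀ (by positivity)]
  linarith

section Sectors

variable {v : Plane → ℂ}

theorem continuous_fderiv_radial (hv : ContDiff ℝ 1 v) : Continuous fun p => fderiv ℝ v p p :=
  (hv.continuous_fderiv one_ne_zero).clm_apply continuous_id

theorem continuous_fderiv_rot (hv : ContDiff ℝ 1 v) : Continuous fun p => fderiv ℝ v p (rot p) :=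
  (hv.continuous_fderiv one_ne_zero).clm_apply continuous_rot

theorem continuous_magSq (hv : ContDiff ℝ 1 v) (B : ℝ) : Continuous (magSq B F0 v) := by
  have h1 := (hv.continuous_fderiv one_ne_zero).clm_apply
    (continuous_const (y := (((1 : ℝ), (0 : ℝ)) : Plane)))
  have h2 := (hv.continuous_fderiv one_ne_zero).clm_apply
    (continuous_const (y := (((0 : ℝ), (1 : ℝ)) : Plane)))
  have h3 := hv.continuous
  unfold magSq F0
  fun_prop

theorem hasDerivAt_comp_logPolar_left (hv : ContDiff ℝ 1 v) (x θ : ℝ) :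
    HasDerivAt (fun y => v (logPolar y θ)) (fderiv ℝ v (logPolar x θ) (logPolar x θ)) x :=
  ((hv.differentiable one_ne_zero _).hasFDerivAt).comp_hasDerivAt x (hasDerivAt_logPolar_left x θ)

theorem hasDerivAt_comp_logPolar_right (hv : ContDiff ℝ 1 v) (x θ : ℝ) :
    HasDerivAt (fun t => v (logPolar x t)) (fderiv ℝ v (logPolar x θ) (rot (logPolar x θ))) θ :=
  ((hv.differentiable one_ne_zero _).hasFDerivAt).comp_hasDerivAt θ
    (hasDerivAt_logPolar_right x θ)

theorem hasDerivAt_sector (hv : ContDiff ℝ 1 v) (m : ℤ) (x : ℝ) :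
    HasDerivAt (sector m v) (sectorDeriv m v x) x := by
  have he : Continuous fun p : ℝ × ℝ => Complex.exp (-(m * p.2 * Complex.I)) := by fun_prop
  exact (hasDerivAt_intervalIntegral_of_continuous
    (G := fun x θ => Complex.exp (-(m * θ * Complex.I)) * v (logPolar x θ))
    (G' := fun x θ => Complex.exp (-(m * θ * Complex.I)) *
      fderiv ℝ v (logPolar x θ) (logPolar x θ))
    (he.mul (hv.continuous.comp continuous_logPolar))
    (he.mul ((continuous_fderiv_radial hv).comp continuous_logPolar))
    (fun y θ => (hasDerivAt_comp_logPolar_left hv y θ).const_mul _) x).const_smul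
      (1 / (2 * Real.pi) : ℝ)

theorem continuous_sectorDeriv (hv : ContDiff ℝ 1 v) (m : ℤ) : Continuous (sectorDeriv m v) :=
  continuous_angCoeff m ((continuous_fderiv_radial hv).comp continuous_logPolar)

theorem continuous_sector (hv : ContDiff ℝ 1 v) (m : ℤ) : Continuous (sector m v) :=
  continuous_angCoeff m (hv.continuous.comp continuous_logPolar)

theorem continuous_logPolar_right (x : ℝ) : Continuous (logPolar x) :=
  continuous_logPolar.comp (by fun_prop : Continuous fun θ : ℝ => (x, θ))

theorem lintegral_norm_sq_eq_tsum_sector (hv : ContDiff ℝ 1 v) :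
    ∫⁻ p in unitDisc, ENNReal.ofReal (‖v p‖ ^ 2) = ENNReal.ofReal (2 * Real.pi) *
      ∑' m : ℤ, ∫⁻ x in Iio (0 : ℝ), ENNReal.ofReal (Real.exp (2 * x) * ‖sector m v x‖ ^ 2) := by
  have hc := hv.continuous
  have hs := continuous_sector hv
  rw [lintegral_unitDisc (by fun_prop), ← lintegral_tsum
    (fun m => (Continuous.measurable (by fun_prop)).ennreal_ofReal.aemeasurable), ← lintegral_const_mul' _ _
    ENNReal.ofReal_ne_top]
  refine lintegral_congr fun x => ?_
  have hcx : Continuous fun θ => v (logPolar x θ) := hc.comp (continuous_logPolar_right x)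
  rw [lintegral_const_mul' _ _ ENNReal.ofReal_ne_top, lintegral_norm_sq_eq_tsum hcx, mul_left_comm,
    ← ENNReal.tsum_mul_left]
  congr 2; ext m
  rw [← ENNReal.ofReal_mul (Real.exp_pos _).le]
  rfl

theorem lintegral_magSq_eq_tsum_sector (hv : ContDiff ℝ 1 v) (B : ℝ) :
    ∫⁻ p in unitDisc, ENNReal.ofReal (magSq B F0 v p) = ENNReal.ofReal (2 * Real.pi) *
      ∑' m : ℤ, ∫⁻ x in Iio (0 : ℝ),
        ENNReal.ofReal (‖sectorDeriv m v x‖ ^ 2 + wt B m x ^ 2 * ‖sector m v x‖ ^ 2) := by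
  have hc := hv.continuous
  have hs := continuous_sector hv
  have hs' := continuous_sectorDeriv hv
  have hm := continuous_magSq hv B
  rw [lintegral_unitDisc (by fun_prop), ← lintegral_tsum
    (fun m => (Continuous.measurable (by fun_prop)).ennreal_ofReal.aemeasurable), ← lintegral_const_mul' _ _
    ENNReal.ofReal_ne_top]
  refine lintegral_congr fun x => ?_
  have hr := (continuous_fderiv_radial hv).comp (continuous_logPolar_right x)
  have ht := (continuous_fderiv_rot hv).comp (continuous_logPolar_right x)
  have hcx := hc.comp (continuous_logPolar_right x)
  simp only [Function.comp_def] at hr ht hcx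
  have e : ∀ θ, ENNReal.ofReal (Real.exp (2 * x)) * ENNReal.ofReal (magSq B F0 v (logPolar x θ)) =
      ENNReal.ofReal (‖fderiv ℝ v (logPolar x θ) (logPolar x θ)‖ ^ 2) +
      ENNReal.ofReal (‖(-Complex.I) * fderiv ℝ v (logPolar x θ) (rot (logPolar x θ)) -
        ((B / 2 * Real.exp (2 * x) : ℝ) : ℂ) * v (logPolar x θ)‖ ^ 2) := fun θ => by
    rw [← ENNReal.ofReal_mul (Real.exp_pos _).le, ← ENNReal.ofReal_add (sq_nonneg _) (sq_nonneg _),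
      ← esq_logPolar x θ, esq_mul_magSq]
  simp only [e]
  rw [lintegral_add_left (by fun_prop), lintegral_norm_sq_eq_tsum hr,
    lintegral_norm_sq_eq_tsum (by fun_prop), ← mul_add, ← ENNReal.tsum_add]
  congr 2; ext m
  rw [← ENNReal.ofReal_add (sq_nonneg _) (sq_nonneg _)]
  congr 2
  rw [angCoeff_sub m (by fun_prop) (by fun_prop), angCoeff_const_mul, angCoeff_const_mul,
    angCoeff_deriv m (hasDerivAt_comp_logPolar_right hv x) ht (by simp [logPolar])]
  have : (-Complex.I) * (Complex.I * m * angCoeff m fun θ => v (logPolar x θ)) -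
      ((B / 2 * Real.exp (2 * x) : ℝ) : ℂ) * (angCoeff m fun θ => v (logPolar x θ)) =
      ((-wt B m x : ℝ) : ℂ) * sector m v x := by
    simp only [wt, sector]
    push_cast
    linear_combination (-(m : ℂ) * angCoeff m fun θ => v (logPolar x θ)) * Complex.I_sq
  rw [this, norm_mul, mul_pow, Complex.norm_real, Real.norm_eq_abs, sq_abs, neg_sq]

end Sectors

theorem isCompact_closure_unitDisc : IsCompact (closure unitDisc) := by
  refine Bornology.IsBounded.isCompact_closure ?_
  refine (Metric.isBounded_closedBall (x := (0 : Plane)) (r := 1)).subset fun p hp => ?_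
  have hp' : p.1 ^ 2 + p.2 ^ 2 < 1 := hp
  rw [mem_closedBall_zero_iff, Prod.norm_def, max_le_iff, Real.norm_eq_abs, Real.norm_eq_abs]
  constructor <;> rw [← sq_le_one_iff_abs_le_one] <;> nlinarith

theorem integrableOn_unitDisc {g : Plane → ℝ} (hg : Continuous g) : IntegrableOn g unitDisc :=
  (hg.continuousOn.integrableOn_compact isCompact_closure_unitDisc).mono_set subset_closure

theorem ofReal_integral_unitDisc {g : Plane → ℝ} (hg : Continuous g) (h0 : ∀ p, 0 ≤ g p) :
    ENNReal.ofReal (∫ p in unitDisc, g p) = ∫⁻ p in unitDisc, ENNReal.ofReal (g p) :=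
  ofReal_integral_eq_lintegral_ofReal (integrableOn_unitDisc hg) (Eventually.of_forall h0)

theorem magSq_nonneg (B : ℝ) (A : Plane → Plane) (u : Plane → ℂ) (p : Plane) :
    0 ≤ magSq B A u p := by unfold magSq; positivity

theorem magSq_congr {B : ℝ} {A : Plane → Plane} {u v : Plane → ℂ} {p : Plane}
    (h : u =ᶠ[𝓝 p] v) : magSq B A u p = magSq B A v p := by
  unfold magSq; rw [h.fderiv_eq, h.eq_of_nhds]

/-- A function of class `C¹` near the closed disc agrees on the disc with a bounded function of
class `C¹` on the plane. -/
theorem CNearCl.exists_contDiff {u : Plane → ℂ} (hu : CNearCl 1 unitDisc u) :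
    ∃ v : Plane → ℂ, ContDiff ℝ 1 v ∧ (∃ M, ∀ p, ‖v p‖ ≤ M) ∧ EqOn u v unitDisc := by
  obtain ⟨U, hU, hcl, hd⟩ := hu
  obtain ⟨L, hL, hL1, hL2⟩ := exists_compact_between isCompact_closure_unitDisc hU hcl
  obtain ⟨φ, hφ1, hφ0, -⟩ := exists_contMDiffMap_one_nhds_of_subset_interior
    (n := 1) (modelWithCornersSelf ℝ Plane) isClosed_closure hL1
  have hφ : ContDiff ℝ 1 φ := φ.contMDiff.contDiff
  have hv : ContDiff ℝ 1 fun p => φ p • u p := by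
    rw [contDiff_iff_contDiffAt]
    intro p
    by_cases hp : p ∈ U
    · exact hφ.contDiffAt.smul (hd.contDiffAt (hU.mem_nhds hp))
    · have hp' : p ∈ Lᶜ := fun h => hp (hL2 h)
      refine (contDiffAt_const (c := (0 : ℂ))).congr_of_eventuallyEq ?_
      filter_upwards [hL.isClosed.isOpen_compl.mem_nhds hp'] with q hq
      rw [hφ0 q hq, zero_smul]
  have hsupp : HasCompactSupport fun p => φ p • u p := HasCompactSupport.intro hL fun p hp => by
    rw [hφ0 p hp, zero_smul]
  refine ⟨_, hv, hv.continuous.bounded_above_of_compact_support hsupp, fun p hp => ?_⟩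
  have : φ p = 1 := hφ1.self_of_nhdsSet p (subset_closure hp)
  simp [this]

theorem exists_sector_lt {v : Plane → ℂ} (hv : ContDiff ℝ 1 v) {B Λ : ℝ} (hΛ : 0 ≤ Λ)
    (h : ∫ p in unitDisc, magSq B F0 v p < Λ * ∫ p in unitDisc, ‖v p‖ ^ 2) :
    ∃ m : ℤ, ∫⁻ x in Iio (0 : ℝ),
        ENNReal.ofReal (‖sectorDeriv m v x‖ ^ 2 + wt B m x ^ 2 * ‖sector m v x‖ ^ 2) <
      ENNReal.ofReal Λ *
        ∫⁻ x in Iio (0 : ℝ), ENNReal.ofReal (Real.exp (2 * x) * ‖sector m v x‖ ^ 2) := by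
  have hc := hv.continuous
  by_contra! hcon
  have hle := ENNReal.tsum_le_tsum hcon
  rw [ENNReal.tsum_mul_left] at hle
  have hle' := mul_le_mul_right hle (ENNReal.ofReal (2 * Real.pi))
  rw [mul_left_comm, ← lintegral_magSq_eq_tsum_sector hv, ← lintegral_norm_sq_eq_tsum_sector hv,
    ← ofReal_integral_unitDisc (continuous_magSq hv B) (magSq_nonneg B F0 v),
    ← ofReal_integral_unitDisc (by fun_prop) (fun p => sq_nonneg _),
    ← ENNReal.ofReal_mul hΛ, ENNReal.ofReal_le_ofReal_iff
      (integral_nonneg fun p => magSq_nonneg B F0 v p)] at hle'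
  linarith

/-- One of the real and imaginary parts of a complex radial function inherits a strict energy
bound. -/
theorem exists_real_part_lt {f f' : ℝ → ℂ} (hf : ∀ x, HasDerivAt f (f' x) x) (hf' : Continuous f')
    {M : ℝ} (hM : ∀ x, ‖f x‖ ≤ M) {B : ℝ} {m : ℤ} {Λ : ENNReal}
    (h : ∫⁻ x in Iio (0 : ℝ), ENNReal.ofReal (‖f' x‖ ^ 2 + wt B m x ^ 2 * ‖f x‖ ^ 2) <
      Λ * ∫⁻ x in Iio (0 : ℝ), ENNReal.ofReal (Real.exp (2 * x) * ‖f x‖ ^ 2)) :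
    ∃ g g' : ℝ → ℝ, (∀ x, HasDerivAt g (g' x) x) ∧ Continuous g' ∧ (∀ x, |g x| ≤ M) ∧
      ∫⁻ x in Iio (0 : ℝ), ENNReal.ofReal (g' x ^ 2 + wt B m x ^ 2 * g x ^ 2) <
      Λ * ∫⁻ x in Iio (0 : ℝ), ENNReal.ofReal (Real.exp (2 * x) * g x ^ 2) := by
  have hre : ∀ x, HasDerivAt (fun x => (f x).re) (f' x).re x := fun x =>
    Complex.reCLM.hasFDerivAt.comp_hasDerivAt x (hf x)
  have him : ∀ x, HasDerivAt (fun x => (f x).im) (f' x).im x := fun x =>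
    Complex.imCLM.hasFDerivAt.comp_hasDerivAt x (hf x)
  have hcr : Continuous fun x => (f x).re :=
    continuous_iff_continuousAt.2 fun x => (hre x).continuousAt
  have hsq : ∀ z : ℂ, ‖z‖ ^ 2 = z.re ^ 2 + z.im ^ 2 := fun z => by
    rw [← Complex.normSq_eq_norm_sq, Complex.normSq_apply]; ring
  by_contra! hcon
  have h1 := hcon _ _ hre (Complex.continuous_re.comp hf')
    fun x => (Complex.abs_re_le_norm _).trans (hM x)
  have h2 := hcon _ _ him (Complex.continuous_im.comp hf')
    fun x => (Complex.abs_im_le_norm _).trans (hM x)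
  refine absurd h (not_lt.2 ?_)
  have e1 : ∀ x, ENNReal.ofReal (‖f' x‖ ^ 2 + wt B m x ^ 2 * ‖f x‖ ^ 2) =
      ENNReal.ofReal ((f' x).re ^ 2 + wt B m x ^ 2 * (f x).re ^ 2) +
      ENNReal.ofReal ((f' x).im ^ 2 + wt B m x ^ 2 * (f x).im ^ 2) := fun x => by
    rw [← ENNReal.ofReal_add (by positivity) (by positivity), hsq, hsq]; congr 1; ring
  have e2 : ∀ x, ENNReal.ofReal (Real.exp (2 * x) * ‖f x‖ ^ 2) =
      ENNReal.ofReal (Real.exp (2 * x) * (f x).re ^ 2) +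
      ENNReal.ofReal (Real.exp (2 * x) * (f x).im ^ 2) := fun x => by
    rw [← ENNReal.ofReal_add (by positivity) (by positivity), hsq]; congr 1; ring
  simp only [e1, e2]
  have hcr' : Continuous fun x => (f' x).re := Complex.continuous_re.comp hf'
  rw [lintegral_add_left (Continuous.measurable (by fun_prop)).ennreal_ofReal,
    lintegral_add_left (Continuous.measurable (by fun_prop)).ennreal_ofReal, mul_add]
  exact add_le_add h1 h2

theorem ofReal_intervalIntegral {g : ℝ → ℝ} (hg : Continuous g) (h0 : ∀ x, 0 ≤ g x) {L : ℝ}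
    (hL : 0 ≤ L) :
    ENNReal.ofReal (∫ x in (-L)..0, g x) = ∫⁻ x in Ico (-L) 0, ENNReal.ofReal (g x) := by
  rw [intervalIntegral.integral_of_le (by linarith),
    Measure.restrict_congr_set Ico_ae_eq_Ioc]
  exact ofReal_integral_eq_lintegral_ofReal (hg.integrableOn_Ioc) (Eventually.of_forall h0)

/-- A bounded radial function on the half-line with small Rayleigh quotient yields an admissible
one. -/
theorem exists_radAdm_lt_of_lintegral {B Λ M : ℝ} {m : ℤ} {f f' : ℝ → ℝ}
    (hf : ∀ x, HasDerivAt f (f' x) x) (hf' : Continuous f') (hM : ∀ x, |f x| ≤ M) (hΛ : 0 ≤ Λ)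
    (h : ∫⁻ x in Iio (0 : ℝ), ENNReal.ofReal (f' x ^ 2 + wt B m x ^ 2 * f x ^ 2) <
      ENNReal.ofReal Λ * ∫⁻ x in Iio (0 : ℝ), ENNReal.ofReal (Real.exp (2 * x) * f x ^ 2)) :
    ∃ a g g', RadAdm a g g' ∧ radE B m a g g' < Λ * radN a g := by
  have hc : Continuous f := continuous_iff_continuousAt.2 fun x => (hf x).continuousAt
  have hfin := ne_top_of_lt h
  have hcover : AECover (volume.restrict (Iio (0 : ℝ))) atTop fun L : ℝ => Ici (-L) :=
    aecover_Ici tendsto_neg_atTop_atBot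
  have hlim := hcover.lintegral_tendsto_of_countably_generated
    (f := fun x => ENNReal.ofReal (Real.exp (2 * x) * f x ^ 2))
    (Continuous.measurable (by fun_prop)).ennreal_ofReal.aemeasurable
  simp only [Measure.restrict_restrict measurableSet_Ici, Ici_inter_Iio] at hlim
  have hev := ((ENNReal.Tendsto.const_mul hlim (Or.inr ENNReal.ofReal_ne_top)).eventually_const_lt
    h).and (eventually_ge_atTop 0)
  obtain ⟨L₀, hlt, hL₀⟩ := hev.exists
  refine exists_radAdm_lt hf hf' (fun x _ => hM x) hL₀ hΛ (fun L hL => ?_)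
    (q := (∫⁻ x in Iio (0 : ℝ), ENNReal.ofReal (f' x ^ 2 + wt B m x ^ 2 * f x ^ 2)).toReal)
    (ENNReal.toReal_lt_of_lt_ofReal ?_)
  · rw [← ENNReal.ofReal_le_iff_le_toReal hfin]
    unfold radE
    rw [ofReal_intervalIntegral (by fun_prop) (fun x => by positivity) (by linarith)]
    exact lintegral_mono_set Ico_subset_Iio_self
  · rw [ENNReal.ofReal_mul hΛ]
    unfold radN
    rw [ofReal_intervalIntegral (by fun_prop) (fun x => by positivity) hL₀]
    exact hlt

/-- The function `f(log r) exp(i m θ)` on the plane. -/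
def ofRadial (m : ℤ) (f : ℝ → ℝ) (p : Plane) : ℂ :=
  if p = 0 then 0 else
    ((f (Real.log (esq p) / 2) * Real.exp (-(m * (Real.log (esq p) / 2))) : ℝ) : ℂ) *
      ((p.1 : ℂ) + p.2 * Complex.I) ^ m

theorem logPolar_ne_zero (x θ : ℝ) : logPolar x θ ≠ 0 := fun h => by
  have := esq_logPolar x θ
  rw [h] at this
  simp [esq] at this
  exact (Real.exp_pos _).ne this

theorem ofRadial_logPolar (m : ℤ) (f : ℝ → ℝ) (x θ : ℝ) :
    ofRadial m f (logPolar x θ) = f x * Complex.exp (m * θ * Complex.I) := by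
  have hz : (((logPolar x θ).1 : ℂ) + (logPolar x θ).2 * Complex.I) =
      Complex.exp (x + θ * Complex.I) := by
    rw [Complex.exp_add, Complex.exp_mul_I]
    simp only [logPolar]; push_cast; ring
  rw [ofRadial, if_neg (logPolar_ne_zero x θ), hz, esq_logPolar, Real.log_exp,
    mul_div_cancel_left₀ _ two_ne_zero, ← Complex.exp_int_mul]
  push_cast
  rw [mul_assoc, ← Complex.exp_add]
  congr 2; ring

theorem esq_pos {p : Plane} (hp : p ≠ 0) : 0 < esq p := by
  unfold esq
  by_contra! h
  refine hp (Prod.ext ?_ ?_)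
  · exact pow_eq_zero_iff two_ne_zero |>.1 (by nlinarith [sq_nonneg p.1, sq_nonneg p.2])
  · exact pow_eq_zero_iff two_ne_zero |>.1 (by nlinarith [sq_nonneg p.1, sq_nonneg p.2])

theorem RadAdm.contDiff_ofRadial {a : ℝ} {f f' : ℝ → ℝ} (h : RadAdm a f f') (m : ℤ) :
    ContDiff ℝ 1 (ofRadial m f) := by
  have hf : ContDiff ℝ 1 f := by
    rw [contDiff_one_iff_deriv]
    refine ⟨fun x => (h.hasDerivAt x).differentiableAt, ?_⟩
    rw [funext fun x => (h.hasDerivAt x).deriv]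
    exact h.cont
  have he : ContDiff ℝ 1 esq := by unfold esq; fun_prop
  rw [contDiff_iff_contDiffAt]
  intro p
  by_cases hp : p = 0
  · subst hp
    refine (contDiffAt_const (c := (0 : ℂ))).congr_of_eventuallyEq ?_
    have hlt : ∀ᶠ q in 𝓝 (0 : Plane), esq q < Real.exp (2 * a) :=
      he.continuous.continuousAt.eventually_lt continuousAt_const
        (by simp [esq, Real.exp_pos])
    filter_upwards [hlt] with q hq
    by_cases hq0 : q = 0
    · rw [ofRadial, if_pos hq0]
    · rw [ofRadial, if_neg hq0, h.eq_zero, zero_mul, Complex.ofReal_zero, zero_mul]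
      have := (Real.log_lt_iff_lt_exp (esq_pos hq0)).2 hq
      linarith
  · have hz : ((p.1 : ℂ) + p.2 * Complex.I) ≠ 0 := fun h0 => hp <| by
      have h1 := congrArg Complex.re h0
      have h2 := congrArg Complex.im h0
      exact Prod.ext (by simpa using h1) (by simpa using h2)
    have hl : ContDiffAt ℝ 1 (fun q => Real.log (esq q) / 2) p :=
      (he.contDiffAt.log (esq_pos hp).ne').div_const 2
    have hg : ContDiffAt ℝ 1 (fun q => f (Real.log (esq q) / 2) *
        Real.exp (-(m * (Real.log (esq q) / 2)))) p :=
      (hf.contDiffAt.comp p hl).mul (contDiffAt_const.mul hl).neg.exp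
    have hw : ContDiff ℝ 1 fun q : Plane => ((q.1 : ℂ) + q.2 * Complex.I) :=
      (Complex.ofRealCLM.contDiff.comp contDiff_fst).add
        ((Complex.ofRealCLM.contDiff.comp contDiff_snd).mul contDiff_const)
    have hwm : ContDiffAt ℝ 1 (fun q : Plane => ((q.1 : ℂ) + q.2 * Complex.I) ^ m) p := by
      cases m with
      | ofNat n => simpa using hw.contDiffAt.pow n
      | negSucc n =>
        simp only [zpow_negSucc]
        exact (hw.contDiffAt.pow (n + 1)).inv (pow_ne_zero _ hz)
    refine ((Complex.ofRealCLM.contDiff.contDiffAt.comp p hg).mul hwm).congr_of_eventuallyEq ?_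
    filter_upwards [isOpen_ne.mem_nhds hp] with q hq
    rw [ofRadial, if_neg hq]
    rfl

theorem norm_sq_ofRadial_logPolar (m : ℤ) (f : ℝ → ℝ) (x θ : ℝ) :
    ‖ofRadial m f (logPolar x θ)‖ ^ 2 = f x ^ 2 := by
  have : (m : ℂ) * θ * Complex.I = ((m * θ : ℝ) : ℂ) * Complex.I := by push_cast; ring
  rw [ofRadial_logPolar, this, norm_mul, Complex.norm_exp_ofReal_mul_I, mul_one,
    Complex.norm_real, Real.norm_eq_abs, sq_abs]

theorem RadAdm.exp_mul_magSq_ofRadial {a : ℝ} {f f' : ℝ → ℝ} (h : RadAdm a f f') (B : ℝ) (m : ℤ)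
    (x θ : ℝ) : Real.exp (2 * x) * magSq B F0 (ofRadial m f) (logPolar x θ) =
      f' x ^ 2 + wt B m x ^ 2 * f x ^ 2 := by
  have hu := h.contDiff_ofRadial m
  have hmθ : (m : ℂ) * θ * Complex.I = ((m * θ : ℝ) : ℂ) * Complex.I := by push_cast; ring
  have h1 : fderiv ℝ (ofRadial m f) (logPolar x θ) (logPolar x θ) =
      f' x * Complex.exp (m * θ * Complex.I) := by
    refine (hasDerivAt_comp_logPolar_left hu x θ).unique ?_
    simp only [ofRadial_logPolar]
    exact (h.hasDerivAt x).ofReal_comp.mul_const _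
  have h2 : fderiv ℝ (ofRadial m f) (logPolar x θ) (rot (logPolar x θ)) =
      f x * (m * Complex.I * Complex.exp (m * θ * Complex.I)) := by
    refine (hasDerivAt_comp_logPolar_right hu x θ).unique ?_
    simp only [ofRadial_logPolar]
    refine HasDerivAt.const_mul _ ?_
    have := ((((hasDerivAt_id θ).ofReal_comp).const_mul (m : ℂ)).mul_const Complex.I).cexp
    refine this.congr_deriv ?_
    simp; ring
  rw [← esq_logPolar x θ, esq_mul_magSq, h1, h2, esq_logPolar, ofRadial_logPolar, hmθ]
  have e : -Complex.I * (f x * (m * Complex.I * Complex.exp (((m * θ : ℝ) : ℂ) * Complex.I))) -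
      ((B / 2 * Real.exp (2 * x) : ℝ) : ℂ) * (f x * Complex.exp (((m * θ : ℝ) : ℂ) * Complex.I)) =
      ((-(wt B m x * f x) : ℝ) : ℂ) * Complex.exp (((m * θ : ℝ) : ℂ) * Complex.I) := by
    unfold wt; push_cast
    linear_combination (-(f x : ℂ) * m * Complex.exp (m * θ * Complex.I)) * Complex.I_sq
  rw [e, norm_mul, norm_mul, Complex.norm_exp_ofReal_mul_I, Complex.norm_real, Complex.norm_real,
    mul_one, mul_one, Real.norm_eq_abs, Real.norm_eq_abs, sq_abs, sq_abs]
  ring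

/-- Integration over the disc of a function whose density in logarithmic polar coordinates does not
depend on the angle. -/
theorem integral_unitDisc_of_logPolar {g : Plane → ℝ} (hg : Continuous g) (h0 : ∀ p, 0 ≤ g p)
    {k : ℝ → ℝ} (hk : Continuous k) (hgk : ∀ x θ, Real.exp (2 * x) * g (logPolar x θ) = k x)
    {a : ℝ} (ha : a ≤ 0) (hka : ∀ x ≤ a, k x = 0) :
    ∫ p in unitDisc, g p = 2 * Real.pi * ∫ x in a..0, k x := by
  have hk0 : ∀ x, 0 ≤ k x := fun x => by
    rw [← hgk x 0]; exact mul_nonneg (Real.exp_pos _).le (h0 _)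
  have hI : 0 ≤ ∫ x in a..0, k x := intervalIntegral.integral_nonneg ha fun x _ => hk0 x
  rw [← ENNReal.ofReal_eq_ofReal_iff (integral_nonneg h0) (by positivity),
    ofReal_integral_unitDisc hg h0, lintegral_unitDisc hg.measurable.ennreal_ofReal,
    ENNReal.ofReal_mul (by positivity)]
  have ha' : a = - -a := by ring
  rw [ha', ofReal_intervalIntegral hk hk0 (by linarith), ← ha']
  have e : ∀ x, ∫⁻ θ in Ioo (-Real.pi) Real.pi,
      ENNReal.ofReal (Real.exp (2 * x)) * ENNReal.ofReal (g (logPolar x θ)) =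
      ENNReal.ofReal (2 * Real.pi) * ENNReal.ofReal (k x) := fun x => by
    simp only [← ENNReal.ofReal_mul (Real.exp_pos _).le, hgk]
    rw [setLIntegral_const, Real.volume_Ioo, mul_comm]
    congr 2; ring
  simp only [e]
  rw [lintegral_const_mul' _ _ ENNReal.ofReal_ne_top]
  congr 1
  rw [← lintegral_indicator measurableSet_Iio, ← lintegral_indicator measurableSet_Ico]
  congr 1; ext x
  rcases le_total x a with hxa | hxa
  · simp [indicator, hka x hxa]
  · simp [indicator, hxa]

theorem lam1_mem_nonneg {Ω : Set Plane} {B r : ℝ} (hr : r ∈ { r : ℝ | ∃ u : Plane → ℂ,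
    CNearCl 1 Ω u ∧ (∫ x in Ω, ‖u x‖ ^ 2) ≠ 0 ∧
    r = (∫ x in Ω, magSq B F0 u x) / (∫ x in Ω, ‖u x‖ ^ 2) }) : 0 ≤ r := by
  obtain ⟨u, -, -, rfl⟩ := hr
  exact div_nonneg (integral_nonneg fun p => magSq_nonneg B F0 u p)
    (integral_nonneg fun p => sq_nonneg _)

theorem radE_nonneg {B : ℝ} {m : ℤ} {a : ℝ} {f f' : ℝ → ℝ} (ha : a ≤ 0) :
    0 ≤ radE B m a f f' :=
  intervalIntegral.integral_nonneg ha fun x _ => by positivity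

theorem radN_nonneg {a : ℝ} {f : ℝ → ℝ} (ha : a ≤ 0) : 0 ≤ radN a f :=
  intervalIntegral.integral_nonneg ha fun x _ => by positivity

theorem radLB_lam1 (B : ℝ) : RadLB B (lam1 unitDisc B) := by
  intro m a f f' h
  have ha : a ≤ 0 := h.le_neg_one.trans (by norm_num)
  have hf := h.continuous
  have hf' := h.cont
  have hu := h.contDiff_ofRadial m
  have hQ : ∫ p in unitDisc, magSq B F0 (ofRadial m f) p = 2 * Real.pi * radE B m a f f' :=
    integral_unitDisc_of_logPolar (continuous_magSq hu B) (magSq_nonneg B F0 _) (by fun_prop)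
      (h.exp_mul_magSq_ofRadial B m) ha fun x hx => by
        simp [h.eq_zero x hx, h.deriv_eq_zero hx]
  have hN : ∫ p in unitDisc, ‖ofRadial m f p‖ ^ 2 = 2 * Real.pi * radN a f :=
    integral_unitDisc_of_logPolar (g := fun p => ‖ofRadial m f p‖ ^ 2)
      (hu.continuous.norm.pow 2) (fun p => sq_nonneg _) (by fun_prop)
      (fun x θ => by rw [norm_sq_ofRadial_logPolar]) ha fun x hx => by
        simp [h.eq_zero x hx]
  rcases (radN_nonneg ha (f := f)).eq_or_lt with h0 | hpos
  · rw [← h0, mul_zero]; exact radE_nonneg ha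
  · rw [← le_div_iff₀ hpos]
    refine csInf_le ⟨0, fun r hr => lam1_mem_nonneg hr⟩ ⟨ofRadial m f,
      ⟨univ, isOpen_univ, subset_univ _, hu.contDiffOn⟩, ?_, ?_⟩
    · rw [hN]; positivity
    · rw [hQ, hN, mul_div_mul_left _ _ (by positivity)]

theorem lam1_nonneg (Ω : Set Plane) (B : ℝ) : 0 ≤ lam1 Ω B :=
  Real.sInf_nonneg fun _ hr => lam1_mem_nonneg hr

theorem volume_unitDisc_pos : 0 < volume unitDisc :=
  isOpen_unitDisc.measure_pos _ ⟨0, by simp [unitDisc]⟩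

theorem exists_radAdm_le_lam1_add (B : ℝ) {ε : ℝ} (hε : 0 < ε) :
    ∃ m a f f', RadAdm a f f' ∧ radN a f = 1 ∧ radE B m a f f' ≤ lam1 unitDisc B + ε := by
  have hΛ : 0 ≤ lam1 unitDisc B + ε := add_nonneg (lam1_nonneg _ _) hε.le
  have hne : { r : ℝ | ∃ u : Plane → ℂ, CNearCl 1 unitDisc u ∧
      (∫ x in unitDisc, ‖u x‖ ^ 2) ≠ 0 ∧
      r = (∫ x in unitDisc, magSq B F0 u x) / (∫ x in unitDisc, ‖u x‖ ^ 2) }.Nonempty := by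
    refine ⟨_, fun _ => 1, ⟨univ, isOpen_univ, subset_univ _, contDiffOn_const⟩, ?_, rfl⟩
    have hfin : volume unitDisc < ⊤ :=
      (measure_mono subset_closure).trans_lt isCompact_closure_unitDisc.measure_lt_top
    simpa [measureReal_def, ENNReal.toReal_eq_zero_iff, hfin.ne] using volume_unitDisc_pos.ne'
  obtain ⟨_, ⟨u, hu, hu0, rfl⟩, hlt⟩ := exists_lt_of_csInf_lt hne
    (lt_add_of_pos_right (lam1 unitDisc B) hε)
  obtain ⟨v, hv, ⟨M, hM⟩, huv⟩ := hu.exists_contDiff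
  rw [div_lt_iff₀ ((integral_nonneg fun p => sq_nonneg _).lt_of_ne' hu0),
    setIntegral_congr_fun isOpen_unitDisc.measurableSet fun p hp => magSq_congr
      (huv.eventuallyEq_of_mem (isOpen_unitDisc.mem_nhds hp)),
    setIntegral_congr_fun isOpen_unitDisc.measurableSet (f := fun p => ‖u p‖ ^ 2)
      (g := fun p => ‖v p‖ ^ 2) fun p hp => by simp only [huv hp]] at hlt
  obtain ⟨m, hm⟩ := exists_sector_lt hv hΛ hlt
  obtain ⟨g, g', hg, hg', hgM, hlt'⟩ := exists_real_part_lt (hasDerivAt_sector hv m)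
    (continuous_sectorDeriv hv m) (fun x => norm_angCoeff_le m fun θ => hM _) hm
  obtain ⟨a, f, f', hf, hE⟩ := exists_radAdm_lt_of_lintegral hg hg' hgM hΛ hlt'
  have ha : a ≤ 0 := hf.le_neg_one.trans (by norm_num)
  have hN : 0 < radN a f := by
    refine (radN_nonneg ha).lt_of_ne' fun h0 => ?_
    rw [h0, mul_zero] at hE
    exact hE.not_ge (radE_nonneg ha)
  set c := (√(radN a f))⁻¹ with hc
  have hc2 : c ^ 2 = (radN a f)⁻¹ := by rw [hc, inv_pow, Real.sq_sqrt hN.le]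
  refine ⟨m, a, fun x => c * f x, fun x => c * f' x, ⟨hf.le_neg_one, fun x =>
    (hf.hasDerivAt x).const_mul c, hf.cont.const_mul c, fun x hx => ?_⟩, ?_, ?_⟩
  · simp [hf.eq_zero x hx]
  · have : radN a (fun x => c * f x) = c ^ 2 * radN a f := by
      unfold radN
      rw [← intervalIntegral.integral_const_mul]
      congr 1; ext x; ring
    rw [this, hc2, inv_mul_cancel₀ hN.ne']
  · have : radE B m a (fun x => c * f x) (fun x => c * f' x) = c ^ 2 * radE B m a f f' := by
      unfold radE
      rw [← intervalIntegral.integral_const_mul]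
      congr 1; ext x; ring
    rw [this, hc2, inv_mul_le_iff₀ hN, mul_comm]
    exact hE.le

theorem lam1_le_lam1_of_le_add {B B' : ℝ} (hB : 10 ^ 8 ≤ B') (hBB : B ≤ B')
    (hd : B' - B ≤ 1 / 100) : lam1 unitDisc B ≤ lam1 unitDisc B' := by
  refine le_of_forall_pos_le_add fun ε hε => ?_
  obtain ⟨m, a, f, f', hf, hN, hE⟩ := exists_radAdm_le_lam1_add B'
    (lt_min hε (by norm_num : (0 : ℝ) < 1 / 2500))
  have hlb := radLB_lam1 B'
  have h1 := radLB_lam1 B m a f f' hf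
  have h2 := radE_le_of_field_le hB hBB hd (hlb.le_field (by linarith)) hlb hf hN
    (hE.trans (by gcongr; exact min_le_right _ _))
  rw [hN, mul_one] at h1
  linarith [min_le_left ε (1 / 2500 : ℝ)]

theorem monotoneOn_lam1 : MonotoneOn (lam1 unitDisc) (Ici (10 ^ 8)) := by
  have key : ∀ n : ℕ, ∀ B B' : ℝ, 10 ^ 8 ≤ B → B ≤ B' → B' - B ≤ n * (1 / 100) →
      lam1 unitDisc B ≤ lam1 unitDisc B' := by
    intro n
    induction n with
    | zero =>
      intro B B' _ h h'
      rw [le_antisymm h (by simpa using h')]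
    | succ n ih =>
      intro B B' hB h h'
      push_cast at h'
      rcases le_total (B' - B) (1 / 100) with hd | hd
      · exact lam1_le_lam1_of_le_add (hB.trans h) h hd
      · exact (ih B (B' - 1 / 100) hB (by linarith) (by linarith)).trans
          (lam1_le_lam1_of_le_add (hB.trans h) (by linarith) (by linarith))
  intro B hB B' _ h
  obtain ⟨n, hn⟩ := exists_nat_ge ((B' - B) * 100)
  exact key n B B' hB h (by linarith)

theorem lam1_unitDisc_le {B : ℝ} (hB : 0 < B) : lam1 unitDisc B ≤ B := (radLB_lam1 B).le_field hB

theorem HlocLow_eq_HlocUp_unitDisc {κ : ℝ} (hκ : 10 ^ 4 < κ) :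
    HlocLow unitDisc κ = HlocUp unitDisc κ := by
  have hκ0 : 0 < κ := by linarith
  have hup : ∀ H, 0 < H → κ ^ 2 ≤ lam1 unitDisc (κ * H) →
      ∀ H', H < H' → κ ^ 2 ≤ lam1 unitDisc (κ * H') := fun H hH h H' hH' => by
    have h1 : (10 : ℝ) ^ 8 ≤ κ * H := by
      have := h.trans (lam1_unitDisc_le (by positivity))
      nlinarith
    have h2 : κ * H ≤ κ * H' := by gcongr
    exact h.trans (monotoneOn_lam1 h1 (h1.trans h2) h2)
  have hbdd : ∀ p : ℝ → Prop, BddBelow {H : ℝ | 0 < H ∧ p H} := fun p => ⟨0, fun H h => h.1.le⟩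
  have hsub : {H : ℝ | 0 < H ∧ κ ^ 2 ≤ lam1 unitDisc (κ * H)} ⊆
      {H : ℝ | 0 < H ∧ ∀ H', H < H' → κ ^ 2 ≤ lam1 unitDisc (κ * H')} :=
    fun H h => ⟨h.1, hup H h.1 h.2⟩
  unfold HlocLow HlocUp
  rcases {H : ℝ | 0 < H ∧ ∀ H', H < H' → κ ^ 2 ≤ lam1 unitDisc (κ * H')}.eq_empty_or_nonempty
    with h0 | ⟨H₀, hH₀⟩
  · rw [h0, subset_empty_iff.1 (hsub.trans h0.subset)]
  · refine le_antisymm (le_csInf ⟨H₀, hH₀⟩ fun H hH => ?_)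
      (csInf_le_csInf (hbdd _) ⟨H₀ + 1, ?_, hH₀.2 _ (by linarith)⟩ hsub)
    · exact le_of_forall_gt_imp_ge_of_dense fun H' hH' =>
        csInf_le (hbdd _) ⟨hH.1.trans hH', hH.2 H' hH'⟩
    · linarith [hH₀.1]

end SC

/-- For the unit disc and large `κ`, the lower and upper local critical
fields coincide. -/
theorem local_fields_coincide_disc :
    ∃ κ₀ > 0, ∀ κ > κ₀, SC.HlocLow SC.unitDisc κ = SC.HlocUp SC.unitDisc κ := by
  exact ⟨10 ^ 4, by norm_num, fun κ hκ => SC.HlocLow_eq_HlocUp_unitDisc hκ⟩
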